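/- arXiv:2106.08084 — 3 statements merged into one kernel-verified Lean document; each statement's English description precedes it below -/
import Mathlib

section
/- Let Y ⊂ ℝ be compact, h : ℝ → ℝ strictly convex, μ the Lebesgue measure on X = [0,1], ν a Borel probability measure on Y, and n ≥ 2 even. Write X_i := [i/n, (i+1)/n] for i ∈ {0,…,n−1}. For k ≥ 1 let 𝒥^{(k)} be the partition of {0,…,n−1} into the sets {2j, 2j+1} (j = 0,…,n/2−1) if k is odd, and into the sets {0}, {1,2}, {3,4}, …, {n−3, n−2}, {n−1} if k is even. Let π^0 = π_init be a Borel probability measure on X×Y with marginals μ and ν, and for k ≥ 1 let π^k be a Borel probability measure on X×Y with marginals μ and ν such that for every J ∈ 𝒥^{(k)}, with X_J := ∪_{i∈J} X_i, the restriction π^k ↾ (X_J×Y) has X-marginal μ ↾ X_J, has the same Y-marginal as π^{k−1} ↾ (X_J×Y), and minimizes ∫ h(x−y) dπ̃(x,y) among all nonnegative measures π̃ on X_J×Y with these two marginals. Assume V < ∞ satisfies ∫_0^{1−δ} W_Y(π_{init,x}, π_{init,x+δ}) dx ≤ δ·V for all δ ∈ (0,1), where (π_{init,x})_{x∈X} is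 the disintegration of π_init with respect to μ. Then for every k ∈ ℕ: Σ_{i=0}^{n−3} W_Y(ρ_i^k, ρ_{i+2}^k) ≤ 2V + 4·diam(Y), where ρ_i^k := n · P_Y(π^k ↾ (X_i×Y)). -/
open MeasureTheory Set Filter
open scoped ENNReal Classical

noncomputable section

/-- Optimal-transport cost with cost function `c`. -/
noncomputable def OTC {A B : Type*} [MeasurableSpace A] [MeasurableSpace B]
    (c : A → B → ℝ≥0∞) (α : Measure A) (β : Measure B) : ℝ≥0∞ :=
  ⨅ (γ : Measure (A × B)) (_ : γ.map Prod.fst = α) (_ : γ.map Prod.snd = β),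
    ∫⁻ p, c p.1 p.2 ∂γ

/-- Wasserstein-1 distance. -/
noncomputable def W1 {S : Type*} [MeasurableSpace S] [PseudoEMetricSpace S]
    (α β : Measure S) : ℝ≥0∞ :=
  OTC edist α β

/-- Disintegration (conditional kernel) of a measure on a product space. -/
noncomputable def disint {α Ω : Type*} [MeasurableSpace α] [MeasurableSpace Ω]
    [StandardBorelSpace Ω] [Nonempty Ω] (π : Measure (α × Ω)) (x : α) : Measure Ω :=
  if h : IsFiniteMeasure π then
    haveI := h
    Measure.condKernel π x
  else 0

/-- Odd-iteration (A) composite cells in one dimension, `n = 2m`: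
`[2j/n, (2j+2)/n]` for `j = 0, …, m−1`. -/
def cellsOdd (m : ℕ) : Set (Set ℝ) :=
  {S | ∃ j : ℕ, j < m ∧ S = Icc ((2*(j:ℝ))/(2*m)) ((2*(j:ℝ)+2)/(2*m))}

/-- Even-iteration (B) composite cells in one dimension, `n = 2m`:
`[(2j−1)/n, (2j+1)/n] ∩ [0,1]` for `j = 0, …, m`, i.e. `{0}, {1,2}, …, {n−3,n−2}, {n−1}`. -/
def cellsEven (m : ℕ) : Set (Set ℝ) :=
  {S | ∃ j : ℕ, j ≤ m ∧
    S = Icc (max 0 ((2*(j:ℝ)-1)/(2*m))) (min 1 ((2*(j:ℝ)+1)/(2*m)))}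

lemma edist_eq_volume_Ico_add_volume_Ico (x y : ℝ) :
    edist x y = volume (Ico x y) + volume (Ico y x) := by
  rw [Real.volume_Ico, Real.volume_Ico, edist_dist, Real.dist_eq]
  rcases le_total x y with hxy | hxy
  · rw [ENNReal.ofReal_of_nonpos (sub_nonpos.2 hxy), add_zero, abs_sub_comm,
      abs_of_nonneg (sub_nonneg.2 hxy)]
  · rw [ENNReal.ofReal_of_nonpos (sub_nonpos.2 hxy), zero_add, abs_of_nonneg (sub_nonneg.2 hxy)]

lemma lintegral_volume_Ico_eq_lintegral_measure {Ω : Type*} [MeasurableSpace Ω] (γ : Measure Ω)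
    [SFinite γ] {f g : Ω → ℝ} (hf : Measurable f) (hg : Measurable g) :
    ∫⁻ p, volume (Ico (f p) (g p)) ∂γ = ∫⁻ t, γ {p | f p ≤ t ∧ t < g p} := by
  have hE : MeasurableSet {z : Ω × ℝ | f z.1 ≤ z.2 ∧ z.2 < g z.1} :=
    (measurableSet_le (hf.comp measurable_fst) measurable_snd).inter
      (measurableSet_lt measurable_snd (hg.comp measurable_fst))
  exact (Measure.prod_apply hE).symm.trans (Measure.prod_apply_symm hE)

lemma lintegral_edist_eq_lintegral_measure (γ : Measure (ℝ × ℝ)) [SFinite γ] :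
    ∫⁻ p, edist p.1 p.2 ∂γ =
      ∫⁻ t, (γ {p | p.1 ≤ t ∧ t < p.2} + γ {p | p.2 ≤ t ∧ t < p.1}) := by
  have hE : MeasurableSet {z : (ℝ × ℝ) × ℝ | z.1.1 ≤ z.2 ∧ z.2 < z.1.2} :=
    (measurableSet_le (measurable_fst.comp measurable_fst) measurable_snd).inter
      (measurableSet_lt measurable_snd (measurable_snd.comp measurable_fst))
  have hm : Measurable fun t => γ {p : ℝ × ℝ | p.1 ≤ t ∧ t < p.2} :=
    measurable_measure_prodMk_right hE
  have hI : Measurable fun p : ℝ × ℝ => volume (Ico p.1 p.2) :=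
    measurable_measure_prodMk_left hE
  simp_rw [edist_eq_volume_Ico_add_volume_Ico]
  rw [lintegral_add_left hI, lintegral_add_left hm,
    lintegral_volume_Ico_eq_lintegral_measure γ measurable_fst measurable_snd,
    lintegral_volume_Ico_eq_lintegral_measure γ measurable_snd measurable_fst]

lemma enorm_eq_ofReal_add_ofReal_neg (x : ℝ) :
    ‖x‖ₑ = ENNReal.ofReal x + ENNReal.ofReal (-x) := by
  rw [Real.enorm_eq_ofReal_abs]
  rcases le_total 0 x with hx | hx
  · rw [abs_of_nonneg hx, ENNReal.ofReal_of_nonpos (neg_nonpos.2 hx), add_zero]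
  · rw [abs_of_nonpos hx, ENNReal.ofReal_of_nonpos hx, zero_add]

lemma ofReal_measureReal_sub_le {Ω : Type*} [MeasurableSpace Ω] (γ : Measure Ω)
    [IsFiniteMeasure γ] (s u : Set Ω) :
    ENNReal.ofReal (γ.real s - γ.real u) ≤ γ (s \ u) := by
  rw [← ofReal_measureReal (μ := γ) (s := s \ u)]
  refine ENNReal.ofReal_le_ofReal ?_
  linarith [measureReal_mono (μ := γ) (show s ⊆ s \ u ∪ u by simp),
    measureReal_union_le (μ := γ) (s \ u) u]

lemma lintegral_enorm_cdf_sub_le_W1 (α β : Measure ℝ) [IsProbabilityMeasure α] :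
    ∫⁻ t, ‖α.real (Iic t) - β.real (Iic t)‖ₑ ≤ W1 α β := by
  refine le_iInf fun γ => le_iInf fun h1 => le_iInf fun h2 => ?_
  have : IsProbabilityMeasure γ := by
    have : IsProbabilityMeasure (γ.map Prod.fst) := h1 ▸ inferInstance
    exact Measure.isProbabilityMeasure_of_map Prod.fst
  rw [lintegral_edist_eq_lintegral_measure]
  refine lintegral_mono fun t => ?_
  rw [enorm_eq_ofReal_add_ofReal_neg, neg_sub, ← h1, ← h2,
    map_measureReal_apply measurable_fst measurableSet_Iic,
    map_measureReal_apply measurable_snd measurableSet_Iic]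
  refine add_le_add ((ofReal_measureReal_sub_le _ _ _).trans (measure_mono ?_))
    ((ofReal_measureReal_sub_le _ _ _).trans (measure_mono ?_)) <;>
  · rintro p ⟨hp, hp'⟩
    exact ⟨hp, not_le.1 hp'⟩

/-- The quantile function of `α`, with values in `[a, b]`. -/
def quantileIcc (a b : ℝ) (α : Measure ℝ) (u : ℝ) : ℝ :=
  sInf {t | t ∈ Icc a b ∧ u ≤ α.real (Iic t)}

section Quantile

variable {a b : ℝ} {α : Measure ℝ}

lemma measureReal_Iic_eq_zero_of_lt (hα : α (Icc a b)ᶜ = 0) {t : ℝ} (ht : t < a) :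
    α.real (Iic t) = 0 := by
  have : α (Iic t) = 0 :=
    measure_mono_null (t := (Icc a b)ᶜ) (fun x hx hx' => absurd (hx'.1.trans hx) (not_le.2 ht)) hα
  simp [measureReal_def, this]

variable [IsProbabilityMeasure α]

lemma le_of_measure_compl_Icc_eq_zero (hα : α (Icc a b)ᶜ = 0) : a ≤ b := by
  by_contra! hab
  simp [Icc_eq_empty_of_lt hab] at hα

lemma measureReal_Iic_eq_one_of_le (hα : α (Icc a b)ᶜ = 0) {t : ℝ} (ht : b ≤ t) :
    α.real (Iic t) = 1 := by
  have : α (Iic t)ᶜ = 0 :=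
    measure_mono_null (compl_subset_compl.2 fun x hx => hx.2.trans ht) hα
  rw [measureReal_def, (prob_compl_eq_zero_iff measurableSet_Iic).1 this, ENNReal.toReal_one]

lemma quantileIcc_le_iff (hα : α (Icc a b)ᶜ = 0) {u : ℝ} (hu : u ∈ Ioc (0 : ℝ) 1) (t : ℝ) :
    quantileIcc a b α u ≤ t ↔ u ≤ α.real (Iic t) := by
  have hab := le_of_measure_compl_Icc_eq_zero hα
  have hb : b ∈ {t | t ∈ Icc a b ∧ u ≤ α.real (Iic t)} :=
    ⟨right_mem_Icc.2 hab, (measureReal_Iic_eq_one_of_le hα le_rfl).symm ▸ hu.2⟩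
  have hbdd : BddBelow {t | t ∈ Icc a b ∧ u ≤ α.real (Iic t)} := ⟨a, fun t ht => ht.1.1⟩
  have hmono {s t : ℝ} (hst : s ≤ t) : α.real (Iic s) ≤ α.real (Iic t) :=
    measureReal_mono (Iic_subset_Iic.2 hst)
  refine ⟨fun ht => le_trans ?_ (hmono ht), fun ht => ?_⟩
  · have hcont := (ProbabilityTheory.cdf α).right_continuous (quantileIcc a b α u)
    have hlim : Tendsto (ProbabilityTheory.cdf α) (nhdsWithin (quantileIcc a b α u)
        (Ioi (quantileIcc a b α u))) (nhds (ProbabilityTheory.cdf α (quantileIcc a b α u))) :=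
      hcont.mono Ioi_subset_Ici_self
    rw [← ProbabilityTheory.cdf_eq_real]
    refine ge_of_tendsto hlim ?_
    filter_upwards [self_mem_nhdsWithin] with s hs
    obtain ⟨r, hr, hrs⟩ := exists_lt_of_csInf_lt ⟨b, hb⟩ hs
    rw [ProbabilityTheory.cdf_eq_real]
    exact hr.2.trans (hmono hrs.le)
  · rcases lt_or_ge t a with hta | hta
    · rw [measureReal_Iic_eq_zero_of_lt hα hta] at ht
      exact absurd hu.1 (not_lt.2 ht)
    rcases le_total t b with htb | htb
    · exact csInf_le hbdd ⟨⟨hta, htb⟩, ht⟩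
    · exact (csInf_le hbdd hb).trans htb

lemma aemeasurable_quantileIcc (hα : α (Icc a b)ᶜ = 0) :
    AEMeasurable (quantileIcc a b α) (volume.restrict (Ioc (0 : ℝ) 1)) := by
  refine aemeasurable_restrict_of_monotoneOn measurableSet_Ioc fun u hu v hv huv => ?_
  rw [quantileIcc_le_iff hα hu]
  exact huv.trans ((quantileIcc_le_iff hα hv _).1 le_rfl)

lemma map_quantileIcc (hα : α (Icc a b)ᶜ = 0) :
    (volume.restrict (Ioc (0 : ℝ) 1)).map (quantileIcc a b α) = α := by
  have hm := aemeasurable_quantileIcc hα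
  refine Measure.ext_of_Iic _ _ fun t => ?_
  have hset : quantileIcc a b α ⁻¹' Iic t ∩ Ioc 0 1 = Ioc 0 (α.real (Iic t)) := by
    ext u
    refine ⟨fun hu => ⟨hu.2.1, (quantileIcc_le_iff hα hu.2 t).1 hu.1⟩, fun hu => ?_⟩
    have hu' : u ∈ Ioc (0 : ℝ) 1 := ⟨hu.1, hu.2.trans measureReal_le_one⟩
    exact ⟨(quantileIcc_le_iff hα hu' t).2 hu.2, hu'⟩
  rw [Measure.map_apply_of_aemeasurable hm measurableSet_Iic,
    Measure.restrict_apply' measurableSet_Ioc, hset, Real.volume_Ioc, sub_zero,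
    ofReal_measureReal]

lemma W1_le_lintegral_enorm_cdf_sub {β : Measure ℝ} [IsProbabilityMeasure β]
    (hα : α (Icc a b)ᶜ = 0) (hβ : β (Icc a b)ᶜ = 0) :
    W1 α β ≤ ∫⁻ t in Icc a b, ‖α.real (Iic t) - β.real (Iic t)‖ₑ := by
  have hmα := aemeasurable_quantileIcc hα
  have hmβ := aemeasurable_quantileIcc hβ
  have hm := hmα.prodMk hmβ
  set γ := (volume.restrict (Ioc (0 : ℝ) 1)).map
    fun u => (quantileIcc a b α u, quantileIcc a b β u) with hγ
  have h1 : γ.map Prod.fst = α := by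
    rw [hγ, AEMeasurable.map_map_of_aemeasurable measurable_fst.aemeasurable hm]
    exact map_quantileIcc hα
  have h2 : γ.map Prod.snd = β := by
    rw [hγ, AEMeasurable.map_map_of_aemeasurable measurable_snd.aemeasurable hm]
    exact map_quantileIcc hβ
  refine (iInf_le_of_le γ (iInf_le_of_le h1 (iInf_le _ h2))).trans ?_
  rw [lintegral_edist_eq_lintegral_measure,
    setLIntegral_eq_of_support_subset (μ := volume) (f := fun t =>
      ‖α.real (Iic t) - β.real (Iic t)‖ₑ)]
  · refine lintegral_mono fun t => ?_
    rw [enorm_eq_ofReal_add_ofReal_neg, neg_sub, hγ,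
      Measure.map_apply_of_aemeasurable hm (by measurability),
      Measure.map_apply_of_aemeasurable hm (by measurability),
      Measure.restrict_apply' measurableSet_Ioc, Measure.restrict_apply' measurableSet_Ioc,
      ← Real.volume_Ioc, ← Real.volume_Ioc]
    refine add_le_add (measure_mono ?_) (measure_mono ?_)
    · rintro u ⟨⟨hu1, hu2⟩, hu⟩
      exact ⟨not_le.1 fun hle => not_le.2 hu2 ((quantileIcc_le_iff hβ hu t).2 hle),
        (quantileIcc_le_iff hα hu t).1 hu1⟩
    · rintro u ⟨⟨hu1, hu2⟩, hu⟩
      exact ⟨not_le.1 fun hle => not_le.2 hu2 ((quantileIcc_le_iff hα hu t).2 hle),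
        (quantileIcc_le_iff hβ hu t).1 hu1⟩
  · intro t ht
    by_contra h
    rw [mem_Icc, not_and_or, not_le, not_le] at h
    refine ht ?_
    rcases h with h | h
    · simp [measureReal_Iic_eq_zero_of_lt hα h, measureReal_Iic_eq_zero_of_lt hβ h]
    · simp [measureReal_Iic_eq_one_of_le hα h.le, measureReal_Iic_eq_one_of_le hβ h.le]

end Quantile

lemma integrable_continuous_comp_of_ae_mem_Icc {Ω : Type*} [MeasurableSpace Ω] {ρ : Measure Ω}
    [IsFiniteMeasure ρ] {h : ℝ → ℝ} (hc : Continuous h) {f : Ω → ℝ} (hf : Measurable f)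
    {l u : ℝ} (hfi : ∀ᵐ ω ∂ρ, f ω ∈ Icc l u) : Integrable (fun ω => h (f ω)) ρ := by
  obtain ⟨C, hC⟩ := isCompact_Icc.exists_bound_of_continuousOn (s := Icc l u) hc.continuousOn
  exact Integrable.of_bound (hc.measurable.comp hf).aestronglyMeasurable C
    (hfi.mono fun ω hω => hC _ hω)

lemma strictConvexOn_cross_lt {h : ℝ → ℝ} (hh : StrictConvexOn ℝ univ h) {x x' y y' : ℝ}
    (hx : x < x') (hy : y' < y) :
    h (x - y') + h (x' - y) < h (x - y) + h (x' - y') := by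
  have hd : 0 < (x' - x) + (y - y') := by linarith
  have hpos : 0 < (x' - x) / ((x' - x) + (y - y')) := div_pos (by linarith) hd
  have hpos' : 0 < (y - y') / ((x' - x) + (y - y')) := div_pos (by linarith) hd
  have hsum : (x' - x) / ((x' - x) + (y - y')) + (y - y') / ((x' - x) + (y - y')) = 1 := by
    field_simp
  have hne : x - y ≠ x' - y' := by linarith
  have h1 := hh.2 (mem_univ (x - y)) (mem_univ (x' - y')) hne hpos hpos' hsum
  have h2 := hh.2 (mem_univ (x - y)) (mem_univ (x' - y')) hne hpos' hpos (by linarith)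
  have e1 : ((x' - x) / ((x' - x) + (y - y'))) • (x - y) +
      ((y - y') / ((x' - x) + (y - y'))) • (x' - y') = x - y' := by
    simp only [smul_eq_mul]; field_simp; ring
  have e2 : ((y - y') / ((x' - x) + (y - y'))) • (x - y) +
      ((x' - x) / ((x' - x) + (y - y'))) • (x' - y') = x' - y := by
    simp only [smul_eq_mul]; field_simp; ring
  rw [e1] at h1
  rw [e2] at h2
  simp only [smul_eq_mul] at h1 h2
  have e3 : (x' - x) / ((x' - x) + (y - y')) = 1 - (y - y') / ((x' - x) + (y - y')) := by linarith
  rw [e3] at h1 h2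
  linarith

/-- Move the mass of `π.restrict P` and `π.restrict Q` along the rectangle swap
`(x, y), (x', y') ↦ (x, y'), (x', y)`. -/
def swapMeasure (π : Measure (ℝ × ℝ)) (P Q : Set (ℝ × ℝ)) : Measure (ℝ × ℝ) :=
  π.restrict (P ∪ Q)ᶜ + (1 - π Q) • π.restrict P + (1 - π P) • π.restrict Q +
    ((π.restrict P).prod (π.restrict Q)).map (fun z => (z.1.1, z.2.2)) +
    ((π.restrict P).prod (π.restrict Q)).map (fun z => (z.2.1, z.1.2))

section Swap

variable {π : Measure (ℝ × ℝ)} {P Q : Set (ℝ × ℝ)}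

lemma restrict_compl_add_restrict_add_restrict (hP : MeasurableSet P) (hQ : MeasurableSet Q)
    (hPQ : Disjoint P Q) :
    π.restrict (P ∪ Q)ᶜ + π.restrict P + π.restrict Q = π := by
  rw [add_assoc, ← Measure.restrict_union hPQ hQ, add_comm,
    Measure.restrict_add_restrict_compl (hP.union hQ)]

variable [IsFiniteMeasure π]

lemma one_sub_smul_add_smul {Ω : Type*} [MeasurableSpace Ω] (ρ : Measure Ω) {q : ℝ≥0∞}
    (hq : q ≤ 1) : (1 - q) • ρ + q • ρ = ρ := by
  rw [← add_smul, tsub_add_cancel_of_le hq, one_smul]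

lemma map_fst_swapMeasure (hπ : π univ ≤ 1) (hP : MeasurableSet P) (hQ : MeasurableSet Q)
    (hPQ : Disjoint P Q) : (swapMeasure π P Q).map Prod.fst = π.map Prod.fst := by
  have hp : π P ≤ 1 := (measure_mono (subset_univ _)).trans hπ
  have hq : π Q ≤ 1 := (measure_mono (subset_univ _)).trans hπ
  have m1 : Measurable fun z : (ℝ × ℝ) × (ℝ × ℝ) => (z.1.1, z.2.2) := by fun_prop
  have m2 : Measurable fun z : (ℝ × ℝ) × (ℝ × ℝ) => (z.2.1, z.1.2) := by fun_prop
  have s1 : (((π.restrict P).prod (π.restrict Q)).map fun z => (z.1.1, z.2.2)).map Prod.fst =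
      (π Q) • (π.restrict P).map Prod.fst := by
    rw [Measure.map_map measurable_fst m1]
    change Measure.map (Prod.fst ∘ Prod.fst) _ = _
    rw [← Measure.map_map measurable_fst measurable_fst, Measure.map_fst_prod, Measure.map_smul,
      Measure.restrict_apply_univ]
  have s2 : (((π.restrict P).prod (π.restrict Q)).map fun z => (z.2.1, z.1.2)).map Prod.fst =
      (π P) • (π.restrict Q).map Prod.fst := by
    rw [Measure.map_map measurable_fst m2]
    change Measure.map (Prod.fst ∘ Prod.snd) _ = _
    rw [← Measure.map_map measurable_fst measurable_snd, Measure.map_snd_prod, Measure.map_smul,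
      Measure.restrict_apply_univ]
  conv_rhs => rw [← restrict_compl_add_restrict_add_restrict (π := π) hP hQ hPQ,
    Measure.map_add _ _ measurable_fst, Measure.map_add _ _ measurable_fst,
    ← one_sub_smul_add_smul ((π.restrict P).map Prod.fst) hq,
    ← one_sub_smul_add_smul ((π.restrict Q).map Prod.fst) hp]
  simp only [swapMeasure, Measure.map_add _ _ measurable_fst, s1, s2, Measure.map_smul]
  abel

lemma map_snd_swapMeasure (hπ : π univ ≤ 1) (hP : MeasurableSet P) (hQ : MeasurableSet Q)
    (hPQ : Disjoint P Q) : (swapMeasure π P Q).map Prod.snd = π.map Prod.snd := by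
  have hp : π P ≤ 1 := (measure_mono (subset_univ _)).trans hπ
  have hq : π Q ≤ 1 := (measure_mono (subset_univ _)).trans hπ
  have m1 : Measurable fun z : (ℝ × ℝ) × (ℝ × ℝ) => (z.1.1, z.2.2) := by fun_prop
  have m2 : Measurable fun z : (ℝ × ℝ) × (ℝ × ℝ) => (z.2.1, z.1.2) := by fun_prop
  have s1 : (((π.restrict P).prod (π.restrict Q)).map fun z => (z.1.1, z.2.2)).map Prod.snd =
      (π P) • (π.restrict Q).map Prod.snd := by
    rw [Measure.map_map measurable_snd m1]
    change Measure.map (Prod.snd ∘ Prod.snd) _ = _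
    rw [← Measure.map_map measurable_snd measurable_snd, Measure.map_snd_prod, Measure.map_smul,
      Measure.restrict_apply_univ]
  have s2 : (((π.restrict P).prod (π.restrict Q)).map fun z => (z.2.1, z.1.2)).map Prod.snd =
      (π Q) • (π.restrict P).map Prod.snd := by
    rw [Measure.map_map measurable_snd m2]
    change Measure.map (Prod.snd ∘ Prod.fst) _ = _
    rw [← Measure.map_map measurable_snd measurable_fst, Measure.map_fst_prod, Measure.map_smul,
      Measure.restrict_apply_univ]
  conv_rhs => rw [← restrict_compl_add_restrict_add_restrict (π := π) hP hQ hPQ,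
    Measure.map_add _ _ measurable_snd, Measure.map_add _ _ measurable_snd,
    ← one_sub_smul_add_smul ((π.restrict P).map Prod.snd) hq,
    ← one_sub_smul_add_smul ((π.restrict Q).map Prod.snd) hp]
  simp only [swapMeasure, Measure.map_add _ _ measurable_snd, s1, s2, Measure.map_smul]
  abel

lemma integral_swapMeasure_lt {h : ℝ → ℝ} (hh : StrictConvexOn ℝ univ h) (hπ : π univ ≤ 1)
    {A B C D : ℝ} (hsupp : ∀ᵐ p ∂π, p ∈ Icc A B ×ˢ Icc C D)
    (hP : MeasurableSet P) (hQ : MeasurableSet Q)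
    (hPQ : ∀ p ∈ P, ∀ q ∈ Q, p.1 < q.1 ∧ q.2 < p.2) (hP0 : π P ≠ 0) (hQ0 : π Q ≠ 0) :
    ∫ p, h (p.1 - p.2) ∂(swapMeasure π P Q) < ∫ p, h (p.1 - p.2) ∂π := by
  have hp : π P ≤ 1 := (measure_mono (subset_univ _)).trans hπ
  have hq : π Q ≤ 1 := (measure_mono (subset_univ _)).trans hπ
  have hdisj : Disjoint P Q := Set.disjoint_left.2 fun p hp hq => (hPQ p hp p hq).1.false
  have hc : Continuous h := continuousOn_univ.1 (hh.convexOn.continuousOn isOpen_univ)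
  set M := (π.restrict P).prod (π.restrict Q) with hM
  have m1 : Measurable fun z : (ℝ × ℝ) × (ℝ × ℝ) => (z.1.1, z.2.2) := by fun_prop
  have m2 : Measurable fun z : (ℝ × ℝ) × (ℝ × ℝ) => (z.2.1, z.1.2) := by fun_prop
  have hM1 : ∀ᵐ z ∂M, z.1 ∈ Icc A B ×ˢ Icc C D ∧ z.1 ∈ P :=
    Measure.quasiMeasurePreserving_fst.ae
      ((ae_restrict_of_ae hsupp).and (ae_restrict_mem hP))
  have hM2 : ∀ᵐ z ∂M, z.2 ∈ Icc A B ×ˢ Icc C D ∧ z.2 ∈ Q :=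
    Measure.quasiMeasurePreserving_snd.ae
      ((ae_restrict_of_ae hsupp).and (ae_restrict_mem hQ))
  have hbox {x y : ℝ} (hx : x ∈ Icc A B) (hy : y ∈ Icc C D) : x - y ∈ Icc (A - D) (B - C) :=
    ⟨by linarith [hx.1, hy.2], by linarith [hx.2, hy.1]⟩
  have hmeas : Measurable fun p : ℝ × ℝ => h (p.1 - p.2) := by
    exact hc.measurable.comp (by fun_prop)
  have iπ : Integrable (fun p : ℝ × ℝ => h (p.1 - p.2)) π :=
    integrable_continuous_comp_of_ae_mem_Icc hc (by fun_prop)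
      (hsupp.mono fun p hp => hbox hp.1 hp.2)
  have i11 : Integrable (fun z : (ℝ × ℝ) × (ℝ × ℝ) => h (z.1.1 - z.1.2)) M :=
    integrable_continuous_comp_of_ae_mem_Icc hc (by fun_prop)
      (hM1.mono fun p hp => hbox hp.1.1 hp.1.2)
  have i22 : Integrable (fun z : (ℝ × ℝ) × (ℝ × ℝ) => h (z.2.1 - z.2.2)) M :=
    integrable_continuous_comp_of_ae_mem_Icc hc (by fun_prop)
      (hM2.mono fun p hp => hbox hp.1.1 hp.1.2)
  have i12 : Integrable (fun z : (ℝ × ℝ) × (ℝ × ℝ) => h (z.1.1 - z.2.2)) M :=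
    integrable_continuous_comp_of_ae_mem_Icc hc (by fun_prop)
      (by filter_upwards [hM1, hM2] with z h1 h2 using hbox h1.1.1 h2.1.2)
  have i21 : Integrable (fun z : (ℝ × ℝ) × (ℝ × ℝ) => h (z.2.1 - z.1.2)) M :=
    integrable_continuous_comp_of_ae_mem_Icc hc (by fun_prop)
      (by filter_upwards [hM1, hM2] with z h1 h2 using hbox h2.1.1 h1.1.2)
  have e11 : ∫ z, h (z.1.1 - z.1.2) ∂M = π.real Q * ∫ p, h (p.1 - p.2) ∂(π.restrict P) := by
    rw [hM, integral_fun_fst (μ := π.restrict P) (ν := π.restrict Q)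
      (fun p : ℝ × ℝ => h (p.1 - p.2)), measureReal_restrict_apply_univ, smul_eq_mul]
  have e22 : ∫ z, h (z.2.1 - z.2.2) ∂M = π.real P * ∫ p, h (p.1 - p.2) ∂(π.restrict Q) := by
    rw [hM, integral_fun_snd (μ := π.restrict P) (ν := π.restrict Q)
      (fun p : ℝ × ℝ => h (p.1 - p.2)), measureReal_restrict_apply_univ, smul_eq_mul]
  have hMne : M ≠ 0 := by
    rw [← Measure.measure_univ_ne_zero, hM, ← univ_prod_univ, Measure.prod_prod,
      Measure.restrict_apply_univ, Measure.restrict_apply_univ]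
    exact mul_ne_zero hP0 hQ0
  have hlt : ∫ z, (h (z.1.1 - z.2.2) + h (z.2.1 - z.1.2)) ∂M <
      ∫ z, (h (z.1.1 - z.1.2) + h (z.2.1 - z.2.2)) ∂M := by
    have hltae : ∀ᵐ z ∂M, h (z.1.1 - z.2.2) + h (z.2.1 - z.1.2) <
        h (z.1.1 - z.1.2) + h (z.2.1 - z.2.2) := by
      filter_upwards [hM1, hM2] with z h1 h2
      obtain ⟨hx, hy⟩ := hPQ _ h1.2 _ h2.2
      exact strictConvexOn_cross_lt hh hx hy
    refine lt_of_le_of_ne (integral_mono_ae (i12.add i21) (i11.add i22)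
      (hltae.mono fun z hz => hz.le)) fun heq => hMne ?_
    have := (integral_eq_iff_of_ae_le (i12.add i21) (i11.add i22)
      (hltae.mono fun z hz => hz.le)).1 heq
    rw [← ae_eq_bot, ← Filter.eventually_false_iff_eq_bot]
    filter_upwards [this, hltae] with z h1 h2
    exact h2.ne h1
  rw [integral_add i12 i21, integral_add i11 i22, e11, e22] at hlt
  have hπint : ∫ p, h (p.1 - p.2) ∂π = ∫ p, h (p.1 - p.2) ∂(π.restrict (P ∪ Q)ᶜ) +
      ∫ p, h (p.1 - p.2) ∂(π.restrict P) + ∫ p, h (p.1 - p.2) ∂(π.restrict Q) := by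
    conv_lhs => rw [← restrict_compl_add_restrict_add_restrict (π := π) hP hQ hdisj]
    rw [integral_add_measure (iπ.restrict.add_measure iπ.restrict) iπ.restrict,
      integral_add_measure iπ.restrict iπ.restrict]
  have j1 : Integrable (fun p : ℝ × ℝ => h (p.1 - p.2))
      ((1 - π Q) • π.restrict P) :=
    iπ.restrict.smul_measure (ne_top_of_le_ne_top ENNReal.one_ne_top tsub_le_self)
  have j2 : Integrable (fun p : ℝ × ℝ => h (p.1 - p.2))
      ((1 - π P) • π.restrict Q) :=
    iπ.restrict.smul_measure (ne_top_of_le_ne_top ENNReal.one_ne_top tsub_le_self)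
  have j3 : Integrable (fun p : ℝ × ℝ => h (p.1 - p.2)) (M.map fun z => (z.1.1, z.2.2)) :=
    (integrable_map_measure hmeas.aestronglyMeasurable m1.aemeasurable).2 i12
  have j4 : Integrable (fun p : ℝ × ℝ => h (p.1 - p.2)) (M.map fun z => (z.2.1, z.1.2)) :=
    (integrable_map_measure hmeas.aestronglyMeasurable m2.aemeasurable).2 i21
  rw [swapMeasure, ← hM, integral_add_measure
      (((iπ.restrict.add_measure j1).add_measure j2).add_measure j3) j4,
    integral_add_measure ((iπ.restrict.add_measure j1).add_measure j2) j3,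
    integral_add_measure (iπ.restrict.add_measure j1) j2,
    integral_add_measure iπ.restrict j1, integral_smul_measure, integral_smul_measure,
    integral_map m1.aemeasurable hmeas.aestronglyMeasurable,
    integral_map m2.aemeasurable hmeas.aestronglyMeasurable, hπint,
    ENNReal.toReal_sub_of_le hq ENNReal.one_ne_top,
    ENNReal.toReal_sub_of_le hp ENNReal.one_ne_top]
  simp only [ENNReal.toReal_one, smul_eq_mul, ← measureReal_def]
  linarith

/-- An optimal plan for a strictly convex cost has the comonotone joint distribution function. -/
lemma measureReal_Iic_prod_Iic_of_optimal {h : ℝ → ℝ} (hh : StrictConvexOn ℝ univ h)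
    (hπ : π univ ≤ 1) {A B C D : ℝ} (hsupp : ∀ᵐ p ∂π, p ∈ Icc A B ×ˢ Icc C D)
    (hopt : ∀ π' : Measure (ℝ × ℝ), π'.map Prod.fst = π.map Prod.fst →
      π'.map Prod.snd = π.map Prod.snd →
      ∫ p, h (p.1 - p.2) ∂π ≤ ∫ p, h (p.1 - p.2) ∂π') (x t : ℝ) :
    π.real (Iic x ×ˢ Iic t) = min (π.real (Iic x ×ˢ univ)) (π.real (univ ×ˢ Iic t)) := by
  have hP : MeasurableSet (Iic x ×ˢ Ioi t) := measurableSet_Iic.prod measurableSet_Ioi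
  have hQ : MeasurableSet (Ioi x ×ˢ Iic t) := measurableSet_Ioi.prod measurableSet_Iic
  have hPQ : ∀ p ∈ Iic x ×ˢ Ioi t, ∀ q ∈ Ioi x ×ˢ Iic t, p.1 < q.1 ∧ q.2 < p.2 :=
    fun p hp q hq => ⟨lt_of_le_of_lt hp.1 hq.1, lt_of_le_of_lt hq.2 hp.2⟩
  have hdisj : Disjoint (Iic x ×ˢ Ioi t) (Ioi x ×ˢ Iic t) :=
    Set.disjoint_left.2 fun p hp hq => (hPQ p hp p hq).1.false
  have h1 : π.real (Iic x ×ˢ univ) = π.real (Iic x ×ˢ Iic t) + π.real (Iic x ×ˢ Ioi t) := by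
    rw [← measureReal_union (Set.disjoint_left.2 fun p hp hq => not_lt.2 (mem_Iic.1 hp.2) hq.2) hP,
      ← prod_union, Iic_union_Ioi]
  have h2 : π.real (univ ×ˢ Iic t) = π.real (Iic x ×ˢ Iic t) + π.real (Ioi x ×ˢ Iic t) := by
    rw [← measureReal_union (Set.disjoint_left.2 fun p hp hq => not_lt.2 (mem_Iic.1 hp.1) hq.1) hQ,
      ← union_prod, Iic_union_Ioi]
  have hzero : π (Iic x ×ˢ Ioi t) = 0 ∨ π (Ioi x ×ˢ Iic t) = 0 := by
    by_contra! hne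
    exact not_lt.2 (hopt _ (map_fst_swapMeasure hπ hP hQ hdisj)
      (map_snd_swapMeasure hπ hP hQ hdisj))
      (integral_swapMeasure_lt hh hπ hsupp hP hQ hPQ hne.1 hne.2)
  rw [h1, h2, min_add_add_left, left_eq_add]
  rcases hzero with h0 | h0
  · rw [measureReal_def, h0, ENNReal.toReal_zero, min_eq_left measureReal_nonneg]
  · rw [measureReal_def π (Ioi x ×ˢ Iic t), h0, ENNReal.toReal_zero,
      min_eq_right measureReal_nonneg]

end Swap

lemma sum_range_two_mul_eq (a : ℕ → ℝ) (M : ℕ) :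
    ∑ i ∈ Finset.range (2 * M), a i = ∑ j ∈ Finset.range M, (a (2 * j) + a (2 * j + 1)) := by
  induction M with
  | zero => simp
  | succ M ih =>
    rw [show 2 * (M + 1) = 2 * M + 1 + 1 by ring, Finset.sum_range_succ, Finset.sum_range_succ,
      Finset.sum_range_succ, ih, add_assoc]

/-- Sorting mass within each pair does not increase the `skip one` variation. -/
lemma sum_abs_sub_add_two_le {g g' : ℕ → ℝ}
    (hmin : ∀ j, g' (2 * j) = min 1 (g (2 * j) + g (2 * j + 1)))
    (hsum : ∀ j, g' (2 * j) + g' (2 * j + 1) = g (2 * j) + g (2 * j + 1)) (M : ℕ) :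
    ∑ i ∈ Finset.range (2 * M), |g' i - g' (i + 2)| ≤
      ∑ i ∈ Finset.range (2 * M), |g i - g (i + 2)| := by
  rw [sum_range_two_mul_eq, sum_range_two_mul_eq]
  refine Finset.sum_le_sum fun j _ => ?_
  have h1 := hmin j
  have h2 := hmin (j + 1)
  have h3 := hsum j
  have h4 := hsum (j + 1)
  rw [show 2 * (j + 1) = 2 * j + 2 by ring] at h2 h4
  rw [show 2 * j + 1 + 2 = 2 * j + 2 + 1 by ring]
  have key : |g' (2 * j) - g' (2 * j + 2)| + |g' (2 * j + 1) - g' (2 * j + 2 + 1)| =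
      |(g (2 * j) + g (2 * j + 1)) - (g (2 * j + 2) + g (2 * j + 2 + 1))| := by
    rw [show g' (2 * j + 1) = g (2 * j) + g (2 * j + 1) - g' (2 * j) by linarith,
      show g' (2 * j + 2 + 1) = g (2 * j + 2) + g (2 * j + 2 + 1) - g' (2 * j + 2) by linarith,
      h1, h2]
    generalize g (2 * j) + g (2 * j + 1) = s
    generalize g (2 * j + 2) + g (2 * j + 2 + 1) = s'
    grind
  rw [key, add_sub_add_comm]
  exact abs_add_le _ _

/-- The sequence `f 0, …, f (2m - 1)`, preceded by three ones and followed by zeros. -/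
def stepExtend (m : ℕ) (f : ℕ → ℝ) (i : ℕ) : ℝ :=
  if i < 3 then 1 else if i < 2 * m + 3 then f (i - 3) else 0

/-- The `skip one` variation of the extended sequence. -/
def stepVariation (m : ℕ) (f : ℕ → ℝ) : ℝ :=
  ∑ i ∈ Finset.range (2 * (m + 2)), |stepExtend m f i - stepExtend m f (i + 2)|

lemma stepVariation_eq {m : ℕ} (hm : 1 ≤ m) (f : ℕ → ℝ) :
    stepVariation m f = |1 - f 0| + |1 - f 1| +
      ∑ i ∈ Finset.range (2 * m - 2), |f i - f (i + 2)| + |f (2 * m - 2)| + |f (2 * m - 1)| := by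
  obtain ⟨m, rfl⟩ := Nat.exists_eq_add_of_le' hm
  have hmid : ∀ i ∈ Finset.range (2 * m),
      |stepExtend (m + 1) f (i + 1 + 1 + 1) - stepExtend (m + 1) f (i + 1 + 1 + 1 + 2)| =
        |f i - f (i + 2)| := by
    intro i hi
    rw [Finset.mem_range] at hi
    simp only [stepExtend]
    rw [if_neg (by omega), if_pos (by omega), if_neg (by omega), if_pos (by omega)]
    congr 3
  rw [stepVariation, show 2 * (m + 1 + 2) = 2 * m + 1 + 1 + 1 + 1 + 1 + 1 by ring,
    Finset.sum_range_succ', Finset.sum_range_succ', Finset.sum_range_succ',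
    Finset.sum_range_succ, Finset.sum_range_succ, Finset.sum_range_succ,
    Finset.sum_congr rfl hmid, show 2 * (m + 1) - 2 = 2 * m by omega,
    show 2 * (m + 1) - 1 = 2 * m + 1 by omega]
  have e0 : stepExtend (m + 1) f 0 = 1 := by simp [stepExtend]
  have e1 : stepExtend (m + 1) f 1 = 1 := by simp [stepExtend]
  have e2 : stepExtend (m + 1) f 2 = 1 := by simp [stepExtend]
  have e3 : stepExtend (m + 1) f 3 = f 0 := by simp [stepExtend]
  have e4 : stepExtend (m + 1) f 4 = f 1 := by
    simp only [stepExtend]; rw [if_neg (by omega), if_pos (by omega)]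
  have l0 : stepExtend (m + 1) f (2 * m + 3) = f (2 * m) := by simp [stepExtend]
  have l1 : stepExtend (m + 1) f (2 * m + 4) = f (2 * m + 1) := by
    simp only [stepExtend]; rw [if_neg (by omega), if_pos (by omega)]; rfl
  have l2 : stepExtend (m + 1) f (2 * m + 5) = 0 := by
    simp only [stepExtend]; rw [if_neg (by omega), if_neg (by omega)]
  have l3 : stepExtend (m + 1) f (2 * m + 6) = 0 := by
    simp only [stepExtend]; rw [if_neg (by omega), if_neg (by omega)]
  have l4 : stepExtend (m + 1) f (2 * m + 7) = 0 := by
    simp only [stepExtend]; rw [if_neg (by omega), if_neg (by omega)]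
  simp only [Nat.add_assoc, Nat.reduceAdd, zero_add, e0, e1, e2, e3, e4, l0, l1, l2, l3, l4,
    sub_self, sub_zero, abs_zero]
  ring

lemma stepVariation_eq_shift (m : ℕ) (f : ℕ → ℝ) :
    stepVariation m f =
      ∑ i ∈ Finset.range (2 * (m + 2)), |stepExtend m f (i + 1) - stepExtend m f (i + 1 + 2)| := by
  have h := (Finset.sum_range_succ (fun i => |stepExtend m f i - stepExtend m f (i + 2)|)
    (2 * (m + 2))).symm.trans (Finset.sum_range_succ' _ _)
  have e0 : stepExtend m f 0 = 1 := by simp [stepExtend]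
  have e2 : stepExtend m f 2 = 1 := by simp [stepExtend]
  have l0 : stepExtend m f (2 * (m + 2)) = 0 := by
    simp only [stepExtend]; rw [if_neg (by omega), if_neg (by omega)]
  have l2 : stepExtend m f (2 * (m + 2) + 2) = 0 := by
    simp only [stepExtend]; rw [if_neg (by omega), if_neg (by omega)]
  simpa [stepVariation, e0, e2, l0, l2] using h

lemma stepVariation_le_of_odd {m : ℕ} {f f' : ℕ → ℝ}
    (hmin : ∀ j < m, f' (2 * j) = min 1 (f (2 * j) + f (2 * j + 1)))
    (hsum : ∀ j < m, f' (2 * j) + f' (2 * j + 1) = f (2 * j) + f (2 * j + 1)) :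
    stepVariation m f' ≤ stepVariation m f := by
  rw [stepVariation_eq_shift, stepVariation_eq_shift]
  have hcell : ∀ g : ℕ → ℝ, ∀ j < m, stepExtend m g (2 * (j + 1) + 1) = g (2 * j) ∧
      stepExtend m g (2 * (j + 1) + 1 + 1) = g (2 * j + 1) := by
    intro g j hj
    simp only [stepExtend]
    rw [if_neg (by omega), if_pos (by omega), if_neg (by omega), if_pos (by omega)]
    exact ⟨congrArg g (by omega), congrArg g (by omega)⟩
  have hout : ∀ g : ℕ → ℝ, ∀ j, m ≤ j → stepExtend m g (2 * (j + 1) + 1) = 0 ∧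
      stepExtend m g (2 * (j + 1) + 1 + 1) = 0 := by
    intro g j hj
    simp only [stepExtend]
    rw [if_neg (by omega), if_neg (by omega), if_neg (by omega), if_neg (by omega)]
    exact ⟨rfl, rfl⟩
  refine sum_abs_sub_add_two_le (g := fun i => stepExtend m f (i + 1))
    (g' := fun i => stepExtend m f' (i + 1)) (fun j => ?_) (fun j => ?_) _
  · rcases j with _ | j
    · simp [stepExtend]
    rcases lt_or_ge j m with hj | hj
    · simp only [hcell _ j hj, hmin j hj]
    · simp [hout _ j hj]
  · rcases j with _ | j
    · simp [stepExtend]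
    rcases lt_or_ge j m with hj | hj
    · simp only [hcell _ j hj, hsum j hj]
    · simp only [hout _ j hj]

lemma stepVariation_le_of_even {m : ℕ} (hm : 1 ≤ m) {f f' : ℕ → ℝ}
    (hf0 : 0 ≤ f 0) (hfl : f (2 * m - 1) ≤ 1)
    (hmin : ∀ j, j + 1 < m → f' (2 * j + 1) = min 1 (f (2 * j + 1) + f (2 * j + 2)))
    (hsum : ∀ j, j + 1 < m → f' (2 * j + 1) + f' (2 * j + 2) = f (2 * j + 1) + f (2 * j + 2))
    (hfirst : f' 0 = f 0) (hlast : f' (2 * m - 1) = f (2 * m - 1)) :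
    stepVariation m f' ≤ stepVariation m f := by
  have hfirst_cell : ∀ g : ℕ → ℝ, stepExtend m g 2 = 1 ∧ stepExtend m g 3 = g 0 := by
    intro g
    simp only [stepExtend]
    rw [if_pos (by omega), if_neg (by omega), if_pos (by omega)]
    exact ⟨rfl, rfl⟩
  have hcell : ∀ g : ℕ → ℝ, ∀ j, j + 1 < m → stepExtend m g (2 * (j + 2)) = g (2 * j + 1) ∧
      stepExtend m g (2 * (j + 2) + 1) = g (2 * j + 2) := by
    intro g j hj
    simp only [stepExtend]
    rw [if_neg (by omega), if_pos (by omega), if_neg (by omega), if_pos (by omega)]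
    exact ⟨congrArg g (by omega), congrArg g (by omega)⟩
  have hlast_cell : ∀ g : ℕ → ℝ, ∀ j, j + 1 = m →
      stepExtend m g (2 * (j + 2)) = g (2 * m - 1) ∧ stepExtend m g (2 * (j + 2) + 1) = 0 := by
    intro g j hj
    simp only [stepExtend]
    rw [if_neg (by omega), if_pos (by omega), if_neg (by omega), if_neg (by omega)]
    exact ⟨congrArg g (by omega), rfl⟩
  have hout : ∀ g : ℕ → ℝ, ∀ j, m < j + 1 → stepExtend m g (2 * (j + 2)) = 0 ∧
      stepExtend m g (2 * (j + 2) + 1) = 0 := by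
    intro g j hj
    simp only [stepExtend]
    rw [if_neg (by omega), if_neg (by omega), if_neg (by omega), if_neg (by omega)]
    exact ⟨rfl, rfl⟩
  refine sum_abs_sub_add_two_le (fun j => ?_) (fun j => ?_) _
  · rcases j with _ | _ | j
    · simp [stepExtend]
    · simp [hfirst_cell, hf0]
    rcases lt_trichotomy (j + 1) m with hj | hj | hj
    · simp only [hcell _ j hj, hmin j hj]
    · simp [hlast_cell _ j hj, hlast, hfl]
    · simp [hout _ j hj]
  · rcases j with _ | _ | j
    · simp [stepExtend]
    · simp [hfirst_cell, hfirst]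
    rcases lt_trichotomy (j + 1) m with hj | hj | hj
    · simp only [hcell _ j hj, hsum j hj]
    · simp [hlast_cell _ j hj, hlast]
    · simp only [hout _ j hj]

/-- The distribution function at `t` of the normalized second marginal of `π` over the cell
`[i / (2m), (i + 1) / (2m)]`. -/
def cellCDF (m : ℕ) (π : Measure (ℝ × ℝ)) (t : ℝ) (i : ℕ) : ℝ :=
  2 * m * π.real (Icc ((i : ℝ) / (2 * m)) (((i : ℝ) + 1) / (2 * m)) ×ˢ Iic t)

lemma measurable_cellCDF (m : ℕ) (π : Measure (ℝ × ℝ)) [IsFiniteMeasure π] (i : ℕ) :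
    Measurable fun t => cellCDF m π t i := by
  have : Monotone fun t => π.real (Icc ((i : ℝ) / (2 * m)) (((i : ℝ) + 1) / (2 * m)) ×ˢ Iic t) :=
    fun s t hst => measureReal_mono (prod_mono_right (Iic_subset_Iic.2 hst))
  exact this.measurable.const_mul _

lemma sum_setLIntegral_Ioc_div (f : ℝ → ℝ≥0∞) {n : ℝ} (hn : 0 < n) (N : ℕ) :
    ∑ i ∈ Finset.range N, ∫⁻ x in Ioc ((i : ℝ) / n) (((i : ℝ) + 1) / n), f x =
      ∫⁻ x in Ioc 0 ((N : ℝ) / n), f x := by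
  induction N with
  | zero => simp
  | succ N ih =>
    rw [Finset.sum_range_succ, ih, ← lintegral_union measurableSet_Ioc
      (Ioc_disjoint_Ioc_of_le le_rfl), Ioc_union_Ioc_eq_Ioc (by positivity) (by gcongr; linarith)]
    push_cast
    rfl

lemma measurable_kernel_Iic (κ : ProbabilityTheory.Kernel ℝ ℝ)
    [ProbabilityTheory.IsMarkovKernel κ] :
    Measurable fun p : ℝ × ℝ => (κ p.1).real (Iic p.2) := by
  have hE : MeasurableSet {z : (ℝ × ℝ) × ℝ | z.2 ≤ z.1.2} :=
    measurableSet_le measurable_snd (measurable_snd.comp measurable_fst)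
  exact (ProbabilityTheory.Kernel.measurable_kernel_prodMk_left
    (κ := κ.comap Prod.fst measurable_fst) hE).ennreal_toReal

lemma measureReal_Icc_prod_eq_integral {π : Measure (ℝ × ℝ)} [IsFiniteMeasure π]
    (hfst : π.map Prod.fst = volume.restrict (Icc (0 : ℝ) 1)) {a b : ℝ} (ha : 0 ≤ a)
    (hb : b ≤ 1) {s : Set ℝ} (hs : MeasurableSet s) :
    π.real (Icc a b ×ˢ s) = ∫ x in Ioc a b, (π.condKernel x).real s := by
  have h1 : π (Icc a b ×ˢ s) = ∫⁻ x in Ioc a b, π.condKernel x s := by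
    conv_lhs => rw [← π.disintegrate π.condKernel]
    rw [Measure.compProd_apply_prod measurableSet_Icc hs, Measure.fst, hfst,
      Measure.restrict_restrict measurableSet_Icc,
      inter_eq_self_of_subset_left (Icc_subset_Icc ha hb), restrict_Ioc_eq_restrict_Icc]
  rw [measureReal_def, h1, ← integral_toReal]
  · rfl
  · exact (ProbabilityTheory.Kernel.measurable_coe _ hs).aemeasurable
  · exact ae_of_all _ fun x => measure_lt_top _ _

lemma lintegral_sum_enorm_cellCDF_sub_le {π : Measure (ℝ × ℝ)} [IsProbabilityMeasure π]
    (hfst : π.map Prod.fst = volume.restrict (Icc (0 : ℝ) 1)) {m : ℕ} {V : ℝ}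
    (hV : ∀ δ : ℝ, 0 < δ → δ < 1 →
      ∫⁻ x in Icc (0 : ℝ) (1 - δ), W1 (disint π x) (disint π (x + δ)) ≤
        ENNReal.ofReal (δ * V)) :
    ∫⁻ t, ∑ i ∈ Finset.range (2 * m - 2), ‖cellCDF m π t i - cellCDF m π t (i + 2)‖ₑ ≤
      ENNReal.ofReal (2 * V) := by
  rcases Nat.lt_or_ge m 2 with hm | hm
  · rw [show 2 * m - 2 = 0 by omega]; simp
  have hm' : (2 : ℝ) ≤ m := by exact_mod_cast hm
  have hn : (0 : ℝ) < 2 * m := by linarith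
  set κ := π.condKernel with hκ
  set δ : ℝ := 2 / (2 * m) with hδ
  have hδ0 : 0 < δ := by positivity
  have hδ1 : δ < 1 := by rw [hδ, div_lt_one hn]; linarith
  have hdis (x : ℝ) : disint π x = κ x := by
    rw [disint, dif_pos (inferInstance : IsFiniteMeasure π)]
  have hmK := measurable_kernel_Iic κ
  have hK (t : ℝ) : Measurable fun x => (κ x).real (Iic t) :=
    hmK.comp (measurable_id.prodMk measurable_const)
  have hint (t a b : ℝ) (c : ℝ) :
      Integrable (fun x => (κ (x + c)).real (Iic t)) (volume.restrict (Ioc a b)) :=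
    Integrable.of_bound ((hK t).comp (measurable_id.add_const c)).aestronglyMeasurable 1
      (ae_of_all _ fun x => by
        rw [Real.norm_of_nonneg measureReal_nonneg]; exact measureReal_le_one)
  have hcell (t : ℝ) : ∀ i ∈ Finset.range (2 * m - 2),
      ‖cellCDF m π t i - cellCDF m π t (i + 2)‖ₑ ≤ ENNReal.ofReal (2 * m) *
        ∫⁻ x in Ioc ((i : ℝ) / (2 * m)) (((i : ℝ) + 1) / (2 * m)),
          ‖(κ x).real (Iic t) - (κ (x + δ)).real (Iic t)‖ₑ := by
    intro i hi
    have hi' : (i : ℝ) + 3 ≤ 2 * m := by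
      have : i + 3 ≤ 2 * m := by rw [Finset.mem_range] at hi; omega
      exact_mod_cast this
    have e1 := measureReal_Icc_prod_eq_integral hfst (a := (i : ℝ) / (2 * m))
      (b := ((i : ℝ) + 1) / (2 * m)) (by positivity) (by rw [div_le_one hn]; linarith)
      (measurableSet_Iic (a := t))
    have e2 := measureReal_Icc_prod_eq_integral hfst (a := ((i + 2 : ℕ) : ℝ) / (2 * m))
      (b := (((i + 2 : ℕ) : ℝ) + 1) / (2 * m)) (by positivity)
      (by rw [div_le_one hn]; push_cast; linarith) (measurableSet_Iic (a := t))
    have hle : (i : ℝ) / (2 * m) ≤ ((i : ℝ) + 1) / (2 * m) := by gcongr; linarith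
    have e3 : ∫ x in Ioc (((i + 2 : ℕ) : ℝ) / (2 * m)) ((((i + 2 : ℕ) : ℝ) + 1) / (2 * m)),
        (κ x).real (Iic t) = ∫ x in Ioc ((i : ℝ) / (2 * m)) (((i : ℝ) + 1) / (2 * m)),
          (κ (x + δ)).real (Iic t) := by
      have hs : ((i + 2 : ℕ) : ℝ) / (2 * m) = (i : ℝ) / (2 * m) + δ := by
        rw [hδ]; push_cast; ring
      have hs' : (((i + 2 : ℕ) : ℝ) + 1) / (2 * m) = ((i : ℝ) + 1) / (2 * m) + δ := by
        rw [hδ]; push_cast; ring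
      rw [hs, hs', ← intervalIntegral.integral_of_le (by linarith),
        ← intervalIntegral.integral_of_le hle,
        intervalIntegral.integral_comp_add_right (fun x => (κ x).real (Iic t))]
    rw [cellCDF, cellCDF, e1, e2, ← hκ, e3, ← mul_sub, ← integral_sub
      (by simpa using hint t _ _ 0) (hint t _ _ δ), enorm_mul, Real.enorm_of_nonneg hn.le]
    gcongr
    exact enorm_integral_le_lintegral_enorm _
  have hN : ((2 * m - 2 : ℕ) : ℝ) / (2 * m) = 1 - δ := by
    rw [hδ, Nat.cast_sub (by omega)]
    push_cast
    field_simp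
  have hjoint : Measurable fun z : ℝ × ℝ =>
      ‖(κ z.2).real (Iic z.1) - (κ (z.2 + δ)).real (Iic z.1)‖ₑ :=
    ((hmK.comp (measurable_snd.prodMk measurable_fst)).sub
      (hmK.comp ((measurable_snd.add_const δ).prodMk measurable_fst))).enorm
  calc ∫⁻ t, ∑ i ∈ Finset.range (2 * m - 2), ‖cellCDF m π t i - cellCDF m π t (i + 2)‖ₑ
      ≤ ∫⁻ t, ENNReal.ofReal (2 * m) * ∫⁻ x in Ioc 0 (1 - δ),
          ‖(κ x).real (Iic t) - (κ (x + δ)).real (Iic t)‖ₑ := by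
        refine lintegral_mono fun t => (Finset.sum_le_sum (hcell t)).trans ?_
        rw [← Finset.mul_sum, sum_setLIntegral_Ioc_div _ hn, hN]
    _ = ENNReal.ofReal (2 * m) * ∫⁻ x in Ioc 0 (1 - δ), ∫⁻ t,
          ‖(κ x).real (Iic t) - (κ (x + δ)).real (Iic t)‖ₑ := by
        rw [lintegral_const_mul' _ _ ENNReal.ofReal_ne_top,
          lintegral_lintegral_swap hjoint.aemeasurable]
    _ ≤ ENNReal.ofReal (2 * m) *
          ∫⁻ x in Icc 0 (1 - δ), W1 (disint π x) (disint π (x + δ)) := by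
        rw [restrict_Ioc_eq_restrict_Icc]
        gcongr with x
        rw [hdis, hdis]
        exact lintegral_enorm_cdf_sub_le_W1 _ _
    _ ≤ ENNReal.ofReal (2 * m) * ENNReal.ofReal (δ * V) := by gcongr; exact hV δ hδ0 hδ1
    _ = ENNReal.ofReal (2 * V) := by
        rw [← ENNReal.ofReal_mul hn.le, hδ]
        congr 1
        field_simp

section Cells

variable {π π₀ : Measure (ℝ × ℝ)}

lemma measure_Icc_prod_univ (hfst : π.map Prod.fst = volume.restrict (Icc (0 : ℝ) 1)) {a b : ℝ}
    (ha : 0 ≤ a) (hb : b ≤ 1) : π (Icc a b ×ˢ univ) = ENNReal.ofReal (b - a) := by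
  rw [prod_univ, ← Measure.map_apply measurable_fst measurableSet_Icc, hfst,
    Measure.restrict_apply measurableSet_Icc,
    inter_eq_self_of_subset_left (Icc_subset_Icc ha hb), Real.volume_Icc]

lemma measureReal_Icc_prod_add [IsFiniteMeasure π]
    (hfst : π.map Prod.fst = volume.restrict (Icc (0 : ℝ) 1)) {a b c : ℝ} (hac : a ≤ c)
    (hcb : c ≤ b) {s : Set ℝ} (hs : MeasurableSet s) :
    π.real (Icc a c ×ˢ s) + π.real (Icc c b ×ˢ s) = π.real (Icc a b ×ˢ s) := by
  have hnull : π ({c} ×ˢ univ) = 0 := by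
    rw [prod_univ, ← Measure.map_apply measurable_fst (measurableSet_singleton c), hfst]
    exact measure_mono_null (t := {c}) (fun x hx => hx) (by simp)
  have hinter : π.real (Icc a c ×ˢ s ∩ Icc c b ×ˢ s) = 0 := by
    rw [measureReal_def, measure_mono_null _ hnull, ENNReal.toReal_zero]
    rintro p ⟨hp, hp'⟩
    exact ⟨le_antisymm hp.1.2 hp'.1.1, mem_univ _⟩
  rw [← measureReal_union_add_inter (measurableSet_Icc.prod hs), hinter, add_zero, ← union_prod,
    Icc_union_Icc_eq_Icc hac hcb]

lemma measureReal_prod_eq_of_map_snd_restrict_eq {J s : Set ℝ} (hs : MeasurableSet s)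
    (hsnd : (π.restrict (J ×ˢ univ)).map Prod.snd = (π₀.restrict (J ×ˢ univ)).map Prod.snd) :
    π.real (J ×ˢ s) = π₀.real (J ×ˢ s) := by
  have hset : Prod.snd ⁻¹' s ∩ J ×ˢ univ = J ×ˢ s := by
    ext p; simp [and_comm]
  have h := congrArg (fun ρ : Measure ℝ => ρ.real s) hsnd
  simpa only [map_measureReal_apply measurable_snd hs,
    measureReal_restrict_apply (measurable_snd hs), hset] using h

lemma measureReal_Icc_prod_Iic_eq_min [IsProbabilityMeasure π] {h : ℝ → ℝ}
    (hh : StrictConvexOn ℝ univ h) {A B C D : ℝ}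
    (hsupp : ∀ᵐ p ∂π, p ∈ Icc A B ×ˢ Icc C D)
    (hfst : π.map Prod.fst = volume.restrict (Icc (0 : ℝ) 1)) {a b c : ℝ} (ha : 0 ≤ a)
    (hac : a ≤ c) (hcb : c ≤ b) (hb : b ≤ 1)
    (hopt : ∀ π' : Measure (ℝ × ℝ),
      π'.map Prod.fst = (π.restrict (Icc a b ×ˢ univ)).map Prod.fst →
      π'.map Prod.snd = (π.restrict (Icc a b ×ˢ univ)).map Prod.snd →
      ∫ p, h (p.1 - p.2) ∂(π.restrict (Icc a b ×ˢ univ)) ≤ ∫ p, h (p.1 - p.2) ∂π') (t : ℝ) :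
    π.real (Icc a c ×ˢ Iic t) = min (c - a) (π.real (Icc a b ×ˢ Iic t)) := by
  have hle : (π.restrict (Icc a b ×ˢ univ)) univ ≤ 1 := by
    rw [Measure.restrict_apply_univ]; exact prob_le_one
  have hmin := measureReal_Iic_prod_Iic_of_optimal hh hle (ae_restrict_of_ae hsupp) hopt c t
  have hIic : Iic c ∩ Icc a b = Icc a c := by
    ext x
    exact ⟨fun hx => ⟨hx.2.1, hx.1⟩, fun hx => ⟨hx.2, hx.1, hx.2.trans hcb⟩⟩
  rw [measureReal_restrict_apply (measurableSet_Iic.prod measurableSet_Iic),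
    measureReal_restrict_apply (measurableSet_Iic.prod MeasurableSet.univ),
    measureReal_restrict_apply (MeasurableSet.univ.prod measurableSet_Iic),
    prod_inter_prod, prod_inter_prod, prod_inter_prod, hIic, inter_univ, univ_inter,
    univ_inter] at hmin
  rw [hmin, measureReal_def π (Icc a c ×ˢ univ),
    measure_Icc_prod_univ hfst ha (hcb.trans hb), ENNReal.toReal_ofReal (sub_nonneg.2 hac)]

lemma cellCDF_mem_Icc [IsProbabilityMeasure π]
    (hfst : π.map Prod.fst = volume.restrict (Icc (0 : ℝ) 1)) {m i : ℕ} (hi : i < 2 * m) (t : ℝ) :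
    cellCDF m π t i ∈ Icc (0 : ℝ) 1 := by
  have hi' : (i : ℝ) + 1 ≤ 2 * m := by exact_mod_cast hi
  have hn : (0 : ℝ) < 2 * m := by have := Nat.cast_nonneg (α := ℝ) i; linarith
  refine ⟨mul_nonneg hn.le measureReal_nonneg, ?_⟩
  have hle : π.real (Icc ((i : ℝ) / (2 * m)) (((i : ℝ) + 1) / (2 * m)) ×ˢ Iic t) ≤
      1 / (2 * m) := by
    refine (measureReal_mono (prod_mono_right (subset_univ _))).trans_eq ?_
    rw [measureReal_def, measure_Icc_prod_univ hfst (by positivity) (by rwa [div_le_one hn]),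
      ← sub_div, add_sub_cancel_left, ENNReal.toReal_ofReal (by positivity)]
  calc cellCDF m π t i ≤ 2 * m * (1 / (2 * m)) := mul_le_mul_of_nonneg_left hle hn.le
    _ = 1 := by rw [mul_one_div_cancel hn.ne']

/-- Optimality on a composite cell sorts the mass within the two basic cells. -/
lemma cellCDF_pair_of_optimal [IsProbabilityMeasure π] [IsProbabilityMeasure π₀] {h : ℝ → ℝ}
    (hh : StrictConvexOn ℝ univ h) {A B C D : ℝ}
    (hsupp : ∀ᵐ p ∂π, p ∈ Icc A B ×ˢ Icc C D)
    (hfst : π.map Prod.fst = volume.restrict (Icc (0 : ℝ) 1))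
    (hfst₀ : π₀.map Prod.fst = volume.restrict (Icc (0 : ℝ) 1)) {m i : ℕ} (hi : i + 1 < 2 * m)
    {J : Set ℝ} (hJ : J = Icc ((i : ℝ) / (2 * m)) (((i : ℝ) + 2) / (2 * m)))
    (hopt : (π.restrict (J ×ˢ univ)).map Prod.fst = (volume.restrict (Icc (0 : ℝ) 1)).restrict J ∧
      (π.restrict (J ×ˢ univ)).map Prod.snd = (π₀.restrict (J ×ˢ univ)).map Prod.snd ∧
      ∀ π' : Measure (ℝ × ℝ),
        π'.map Prod.fst = (volume.restrict (Icc (0 : ℝ) 1)).restrict J →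
        π'.map Prod.snd = (π₀.restrict (J ×ˢ univ)).map Prod.snd →
        ∫ p, h (p.1 - p.2) ∂(π.restrict (J ×ˢ univ)) ≤ ∫ p, h (p.1 - p.2) ∂π') (t : ℝ) :
    cellCDF m π t i = min 1 (cellCDF m π₀ t i + cellCDF m π₀ t (i + 1)) ∧
      cellCDF m π t i + cellCDF m π t (i + 1) =
        cellCDF m π₀ t i + cellCDF m π₀ t (i + 1) := by
  subst hJ
  obtain ⟨h1, h2, h3⟩ := hopt
  have hi' : (i : ℝ) + 2 ≤ 2 * m := by exact_mod_cast hi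
  have hn : (0 : ℝ) < 2 * m := by have := Nat.cast_nonneg (α := ℝ) i; linarith
  have hac : (i : ℝ) / (2 * m) ≤ ((i : ℝ) + 1) / (2 * m) := by gcongr; linarith
  have hcb : ((i : ℝ) + 1) / (2 * m) ≤ ((i : ℝ) + 2) / (2 * m) := by gcongr; linarith
  have hmin := measureReal_Icc_prod_Iic_eq_min hh hsupp hfst (a := (i : ℝ) / (2 * m))
    (by positivity) hac hcb (by rwa [div_le_one hn])
    (fun π' e1 e2 => h3 π' (e1.trans h1) (e2.trans h2)) t
  have hJ := measureReal_prod_eq_of_map_snd_restrict_eq (measurableSet_Iic (a := t)) h2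
  have hadd := measureReal_Icc_prod_add hfst hac hcb (measurableSet_Iic (a := t))
  have hadd₀ := measureReal_Icc_prod_add hfst₀ hac hcb (measurableSet_Iic (a := t))
  have hcast : ((i : ℝ) + 1) + 1 = i + 2 := by ring
  simp only [cellCDF, Nat.cast_add, Nat.cast_one, hcast, ← mul_add, hadd, hadd₀, hJ, and_true]
  rw [hmin, hJ, mul_min_of_nonneg _ _ hn.le]
  rw [← sub_div, add_sub_cancel_left, mul_one_div_cancel hn.ne']

end Cells

section Iterates

variable {h : ℝ → ℝ} {m : ℕ} {πs : ℕ → Measure (ℝ × ℝ)}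

lemma stepVariation_cellCDF_antitone (hh : StrictConvexOn ℝ univ h) (hm : 1 ≤ m)
    (hP : ∀ k, IsProbabilityMeasure (πs k))
    (hfst : ∀ k, (πs k).map Prod.fst = volume.restrict (Icc (0 : ℝ) 1)) {A B C D : ℝ}
    (hsupp : ∀ k, ∀ᵐ p ∂(πs k), p ∈ Icc A B ×ˢ Icc C D)
    (hiter : ∀ k, 1 ≤ k → ∀ J ∈ (if k % 2 = 1 then cellsOdd m else cellsEven m),
      ((πs k).restrict (J ×ˢ univ)).map Prod.fst = (volume.restrict (Icc (0 : ℝ) 1)).restrict J ∧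
      ((πs k).restrict (J ×ˢ univ)).map Prod.snd =
        ((πs (k - 1)).restrict (J ×ˢ univ)).map Prod.snd ∧
      ∀ π' : Measure (ℝ × ℝ),
        π'.map Prod.fst = (volume.restrict (Icc (0 : ℝ) 1)).restrict J →
        π'.map Prod.snd = ((πs (k - 1)).restrict (J ×ˢ univ)).map Prod.snd →
        ∫ p, h (p.1 - p.2) ∂((πs k).restrict (J ×ˢ univ)) ≤ ∫ p, h (p.1 - p.2) ∂π') (t : ℝ) :
    Antitone fun k => stepVariation m (cellCDF m (πs k) t) := by
  have hm' : (1 : ℝ) ≤ m := by exact_mod_cast hm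
  have hn : (0 : ℝ) < 2 * m := by linarith
  refine antitone_nat_of_succ_le fun k => ?_
  have hk := hiter (k + 1) (by omega)
  rw [Nat.add_sub_cancel] at hk
  split_ifs at hk with hodd
  · have hpair (j : ℕ) (hj : j < m) := cellCDF_pair_of_optimal hh (hsupp (k + 1)) (hfst (k + 1))
      (hfst k) (m := m) (i := 2 * j) (by omega) (by push_cast; rfl) (hk _ ⟨j, hj, rfl⟩) t
    exact stepVariation_le_of_odd (fun j hj => (hpair j hj).1) fun j hj => (hpair j hj).2
  · have hpair (j : ℕ) (hj : j + 1 < m) := cellCDF_pair_of_optimal hh (hsupp (k + 1))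
      (hfst (k + 1)) (hfst k) (m := m) (i := 2 * j + 1) (by omega) (by
        have hj' : (j : ℝ) + 1 + 1 ≤ m := by exact_mod_cast hj
        have hj0 := Nat.cast_nonneg (α := ℝ) j
        rw [max_eq_right (div_nonneg (by push_cast; linarith) hn.le),
          min_eq_right ((div_le_one hn).2 (by push_cast; linarith))]
        push_cast
        congr 2 <;> ring) (hk _ ⟨j + 1, hj.le, rfl⟩) t
    have hfirst := measureReal_prod_eq_of_map_snd_restrict_eq (measurableSet_Iic (a := t))
      (hk _ ⟨0, by omega, rfl⟩).2.1
    have hlast := measureReal_prod_eq_of_map_snd_restrict_eq (measurableSet_Iic (a := t))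
      (hk _ ⟨m, le_rfl, rfl⟩).2.1
    rw [max_eq_left (div_nonpos_of_nonpos_of_nonneg (by simp) hn.le),
      min_eq_right ((div_le_one hn).2 (by push_cast; linarith))] at hfirst
    rw [max_eq_right (div_nonneg (by linarith) hn.le),
      min_eq_left ((one_le_div hn).2 (by linarith))] at hlast
    refine stepVariation_le_of_even hm (cellCDF_mem_Icc (hfst k) (by omega) t).1
      (cellCDF_mem_Icc (hfst k) (by omega) t).2 (fun j hj => (hpair j hj).1)
      (fun j hj => (hpair j hj).2) ?_ ?_
    · simpa [cellCDF] using Or.inl hfirst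
    · have hcast : ((2 * m - 1 : ℕ) : ℝ) = 2 * m - 1 := by
        rw [Nat.cast_sub (by omega)]; push_cast; rfl
      rw [cellCDF, cellCDF, hcast, sub_add_cancel, div_self hn.ne', hlast]

lemma sum_enorm_cellCDF_sub_le (hm : 1 ≤ m) {π π₀ : Measure (ℝ × ℝ)} [IsProbabilityMeasure π₀]
    (hfst₀ : π₀.map Prod.fst = volume.restrict (Icc (0 : ℝ) 1)) {t : ℝ}
    (hle : stepVariation m (cellCDF m π t) ≤ stepVariation m (cellCDF m π₀ t)) :
    ∑ i ∈ Finset.range (2 * m - 2), ‖cellCDF m π t i - cellCDF m π t (i + 2)‖ₑ ≤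
      ∑ i ∈ Finset.range (2 * m - 2), ‖cellCDF m π₀ t i - cellCDF m π₀ t (i + 2)‖ₑ + 4 := by
  rw [stepVariation_eq hm, stepVariation_eq hm] at hle
  have hend {i : ℕ} (hi : i < 2 * m) :
      |1 - cellCDF m π₀ t i| ≤ 1 ∧ |cellCDF m π₀ t i| ≤ 1 := by
    obtain ⟨h0, h1⟩ := cellCDF_mem_Icc hfst₀ hi t
    exact ⟨abs_le.2 ⟨by linarith, by linarith⟩, abs_le.2 ⟨by linarith, h1⟩⟩
  have h0 := (hend (i := 0) (by omega)).1
  have h1 := (hend (i := 1) (by omega)).1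
  have h2 := (hend (i := 2 * m - 2) (by omega)).2
  have h3 := (hend (i := 2 * m - 1) (by omega)).2
  simp only [Real.enorm_eq_ofReal_abs]
  rw [← ENNReal.ofReal_sum_of_nonneg fun _ _ => abs_nonneg _,
    ← ENNReal.ofReal_sum_of_nonneg fun _ _ => abs_nonneg _,
    show (4 : ℝ≥0∞) = ENNReal.ofReal 4 by norm_num,
    ← ENNReal.ofReal_add (Finset.sum_nonneg fun _ _ => abs_nonneg _) (by norm_num)]
  refine ENNReal.ofReal_le_ofReal ?_
  linarith [abs_nonneg (1 - cellCDF m π t 0), abs_nonneg (1 - cellCDF m π t 1),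
    abs_nonneg (cellCDF m π t (2 * m - 2)), abs_nonneg (cellCDF m π t (2 * m - 1))]

end Iterates

/-- The normalized second marginal of `π` over `[i / (2m), (i + 1) / (2m)]`. -/
def cellMarginal (m : ℕ) (π : Measure (ℝ × ℝ)) (i : ℕ) : Measure ℝ :=
  (2 * m : ℝ≥0∞) •
    (π.restrict (Icc ((i : ℝ) / (2 * m)) (((i : ℝ) + 1) / (2 * m)) ×ˢ univ)).map Prod.snd

section Marginal

variable {m i : ℕ} {π : Measure (ℝ × ℝ)}

lemma isProbabilityMeasure_cellMarginal
    (hfst : π.map Prod.fst = volume.restrict (Icc (0 : ℝ) 1)) (hi : i < 2 * m) :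
    IsProbabilityMeasure (cellMarginal m π i) := by
  have hi' : (i : ℝ) + 1 ≤ 2 * m := by exact_mod_cast hi
  have hn : (0 : ℝ) < 2 * m := by have := Nat.cast_nonneg (α := ℝ) i; linarith
  have hcast : (2 * m : ℝ≥0∞) = ENNReal.ofReal (2 * m) := by
    rw [ENNReal.ofReal_mul (by norm_num), ENNReal.ofReal_natCast]; norm_num
  constructor
  rw [cellMarginal, Measure.smul_apply, Measure.map_apply measurable_snd MeasurableSet.univ,
    preimage_univ, Measure.restrict_apply_univ,
    measure_Icc_prod_univ hfst (by positivity) (by rwa [div_le_one hn]), smul_eq_mul, hcast,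
    ← ENNReal.ofReal_mul hn.le, ← sub_div, add_sub_cancel_left, mul_one_div_cancel hn.ne',
    ENNReal.ofReal_one]

lemma cellMarginal_real_Iic (t : ℝ) : (cellMarginal m π i).real (Iic t) = cellCDF m π t i := by
  have hset : Prod.snd ⁻¹' Iic t ∩ Icc ((i : ℝ) / (2 * m)) (((i : ℝ) + 1) / (2 * m)) ×ˢ univ =
      Icc ((i : ℝ) / (2 * m)) (((i : ℝ) + 1) / (2 * m)) ×ˢ Iic t := by
    ext p; simp [and_comm]
  rw [cellMarginal, measureReal_ennreal_smul_apply,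
    map_measureReal_apply measurable_snd measurableSet_Iic,
    measureReal_restrict_apply (measurable_snd measurableSet_Iic), hset, cellCDF]
  simp

lemma cellMarginal_apply_eq_zero {s : Set ℝ} (hs : MeasurableSet s)
    (h0 : π.map Prod.snd s = 0) : cellMarginal m π i s = 0 := by
  rw [Measure.map_apply measurable_snd hs] at h0
  rw [cellMarginal, Measure.smul_apply, Measure.map_apply measurable_snd hs,
    Measure.restrict_apply (measurable_snd hs), measure_mono_null inter_subset_left h0, smul_zero]

end Marginal

/-- one-dimensional oscillation bound.  For the domain decomposition iterates
with `μ = Leb ↾ [0,1]`, strictly convex cost `h(x−y)` and no regularization, the basic-cell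
"skip one" Wasserstein total variation of every iterate is bounded by `2V + 4 diam Y`,
where `V` bounds the initial Wasserstein variation. -/
theorem stmt3 (Y : Set ℝ) (hY : IsCompact Y)
    (h : ℝ → ℝ) (hh : StrictConvexOn ℝ univ h)
    (ν : Measure ℝ) (hνP : IsProbabilityMeasure ν) (hν : ν Yᶜ = 0)
    (m : ℕ) (hm : 1 ≤ m)
    (πs : ℕ → Measure (ℝ × ℝ))
    (hP : ∀ k, IsProbabilityMeasure (πs k))
    (hfst : ∀ k, (πs k).map Prod.fst = volume.restrict (Icc (0:ℝ) 1))
    (hsnd : ∀ k, (πs k).map Prod.snd = ν)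
    (hiter : ∀ k, 1 ≤ k → ∀ J ∈ (if k % 2 = 1 then cellsOdd m else cellsEven m),
      ((πs k).restrict (J ×ˢ univ)).map Prod.fst = (volume.restrict (Icc (0:ℝ) 1)).restrict J ∧
      ((πs k).restrict (J ×ˢ univ)).map Prod.snd =
        ((πs (k-1)).restrict (J ×ˢ univ)).map Prod.snd ∧
      ∀ π' : Measure (ℝ × ℝ),
        π'.map Prod.fst = (volume.restrict (Icc (0:ℝ) 1)).restrict J →
        π'.map Prod.snd = ((πs (k-1)).restrict (J ×ˢ univ)).map Prod.snd →
        ∫ p, h (p.1 - p.2) ∂((πs k).restrict (J ×ˢ univ)) ≤ ∫ p, h (p.1 - p.2) ∂π')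
    (V : ℝ)
    (hV : ∀ δ : ℝ, 0 < δ → δ < 1 →
      ∫⁻ x in Icc (0:ℝ) (1 - δ), W1 (disint (πs 0) x) (disint (πs 0) (x + δ)) ≤
        ENNReal.ofReal (δ * V)) :
    ∀ k : ℕ, ∑ i ∈ Finset.range (2*m - 2),
        W1 ((2*m : ℝ≥0∞) •
              ((πs k).restrict (Icc ((i:ℝ)/(2*m)) (((i:ℝ)+1)/(2*m)) ×ˢ univ)).map Prod.snd)
          ((2*m : ℝ≥0∞) •
              ((πs k).restrict (Icc (((i:ℝ)+2)/(2*m)) (((i:ℝ)+3)/(2*m)) ×ˢ univ)).map Prod.snd)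
      ≤ ENNReal.ofReal (2*V) + 4 * EMetric.diam Y := by
  intro k
  have hsub : Y ⊆ Icc (sInf Y) (sSup Y) :=
    fun y hy => ⟨csInf_le hY.bddBelow hy, le_csSup hY.bddAbove hy⟩
  have hνI : ν (Icc (sInf Y) (sSup Y))ᶜ = 0 := measure_mono_null (compl_subset_compl.2 hsub) hν
  have hsupp (k : ℕ) : ∀ᵐ p ∂(πs k), p ∈ Icc (0 : ℝ) 1 ×ˢ Icc (sInf Y) (sSup Y) := by
    have h1 : ∀ᵐ p ∂(πs k), p.1 ∈ Icc (0 : ℝ) 1 :=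
      ae_of_ae_map measurable_fst.aemeasurable (hfst k ▸ ae_restrict_mem measurableSet_Icc)
    have h2 : ∀ᵐ p ∂(πs k), p.2 ∈ Icc (sInf Y) (sSup Y) :=
      ae_of_ae_map measurable_snd.aemeasurable (by rw [hsnd k]; exact hνI)
    filter_upwards [h1, h2] with p hp hp' using ⟨hp, hp'⟩
  have hzero (i : ℕ) : cellMarginal m (πs k) i (Icc (sInf Y) (sSup Y))ᶜ = 0 :=
    cellMarginal_apply_eq_zero measurableSet_Icc.compl (by rw [hsnd k]; exact hνI)
  calc _ ≤ ∑ i ∈ Finset.range (2 * m - 2), ∫⁻ t in Icc (sInf Y) (sSup Y),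
          ‖cellCDF m (πs k) t i - cellCDF m (πs k) t (i + 2)‖ₑ := by
        refine Finset.sum_le_sum fun i hi => ?_
        rw [Finset.mem_range] at hi
        have := isProbabilityMeasure_cellMarginal (hfst k) (show i < 2 * m by omega)
        have := isProbabilityMeasure_cellMarginal (hfst k) (show i + 2 < 2 * m by omega)
        have hW := W1_le_lintegral_enorm_cdf_sub (hzero i) (hzero (i + 2))
        simp only [cellMarginal_real_Iic] at hW
        refine le_of_eq_of_le ?_ hW
        rw [cellMarginal, cellMarginal]
        push_cast
        rw [show (i : ℝ) + 2 + 1 = i + 3 by ring]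
    _ = ∫⁻ t in Icc (sInf Y) (sSup Y), ∑ i ∈ Finset.range (2 * m - 2),
          ‖cellCDF m (πs k) t i - cellCDF m (πs k) t (i + 2)‖ₑ :=
        (lintegral_finsetSum _ fun i _ => ((measurable_cellCDF m (πs k) i).sub
          (measurable_cellCDF m (πs k) (i + 2))).enorm).symm
    _ ≤ ∫⁻ t in Icc (sInf Y) (sSup Y), (∑ i ∈ Finset.range (2 * m - 2),
          ‖cellCDF m (πs 0) t i - cellCDF m (πs 0) t (i + 2)‖ₑ + 4) :=
        lintegral_mono fun t => sum_enorm_cellCDF_sub_le hm (hfst 0)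
          (stepVariation_cellCDF_antitone hh hm hP hfst hsupp hiter t (Nat.zero_le k))
    _ = (∫⁻ t in Icc (sInf Y) (sSup Y), ∑ i ∈ Finset.range (2 * m - 2),
          ‖cellCDF m (πs 0) t i - cellCDF m (πs 0) t (i + 2)‖ₑ) + 4 * Metric.ediam Y := by
        rw [lintegral_add_right _ measurable_const, lintegral_const,
          Measure.restrict_apply_univ, Real.volume_Icc, ← Real.ediam_eq hY.isBounded]
    _ ≤ ENNReal.ofReal (2 * V) + 4 * Metric.ediam Y :=
        add_le_add_left ((setLIntegral_le_lintegral _ _).trans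
          (lintegral_sum_enorm_cellCDF_sub_le (hfst 0) hV)) _
end
end

section
/- Let Z ⊂ ℝ^{d₁} and Y ⊂ ℝ^{d₂} be compact sets. Let g^n, g : Z×Y → ℝ be continuous with g^n → g uniformly, and let η^n ≥ 0 be reals with η^n → η ∈ [0,∞). Let σ^n, σ be Borel probability measures on Z with σ^n → σ weakly*, and let ρ^n, ρ be Borel probability measures on Y with ρ^n → ρ weakly*. Then for every λ ∈ Π(σ, ρ) there exist λ^n ∈ Π(σ^n, ρ^n) with λ^n → λ weakly* and limsup_{n→∞} [ ∫_{Z×Y} g^n dλ^n + η^n·KL(λ^n | σ^n⊗ρ^n) ] ≤ ∫_{Z×Y} g dλ + η·KL(λ | σ⊗ρ), with the convention 0·(+∞) = 0. -/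
open MeasureTheory Set Filter
open scoped ENNReal Classical

noncomputable section

abbrev E (d : ℕ) : Type := EuclideanSpace ℝ (Fin d)

/-- Kullback–Leibler divergence via `φ(s) = s log s − s + 1`. -/
def KLphi (s : ℝ) : ℝ := s * Real.log s - s + 1

noncomputable def KL {A : Type*} [MeasurableSpace A] (α β : Measure A) : ℝ≥0∞ :=
  if α ≪ β then ∫⁻ x, ENNReal.ofReal (KLphi ((α.rnDeriv β x).toReal)) ∂β else ⊤

/-- Product of two measures. -/
noncomputable def prodM {A B : Type*} [MeasurableSpace A] [MeasurableSpace B]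
    (α : Measure A) (β : Measure B) : Measure (A × B) :=
  α.bind fun a => β.map (Prod.mk a)

/-- Weak* convergence of measures: convergence of integrals of all continuous functions. -/
def WkTendsto {A : Type*} [MeasurableSpace A] [TopologicalSpace A]
    (μs : ℕ → Measure A) (μ : Measure A) : Prop :=
  ∀ g : A → ℝ, Continuous g →
    Tendsto (fun n => ∫ x, g x ∂μs n) atTop (nhds (∫ x, g x ∂μ))

theorem KLphi_eq_klFun : KLphi = InformationTheory.klFun := by
  ext s
  simp only [KLphi, InformationTheory.klFun]
  ring

theorem convexOn_KLphi : ConvexOn ℝ (Ici 0) KLphi :=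
  KLphi_eq_klFun ▸ InformationTheory.convexOn_klFun

theorem continuous_KLphi : Continuous KLphi :=
  KLphi_eq_klFun ▸ InformationTheory.continuous_klFun

theorem KLphi_nonneg {s : ℝ} (hs : 0 ≤ s) : 0 ≤ KLphi s :=
  KLphi_eq_klFun ▸ InformationTheory.klFun_nonneg hs

open Finset in
/-- A coupling matrix of two probability vectors is the limit, up to mixing with the product
coupling, of couplings of any approximating probability vectors; everything is stated for the
densities with respect to the product coupling. -/
theorem exists_tendsto_couplingDensity {ι κ : Type*} [Fintype ι] [Fintype κ]
    (w : ι → κ → ℝ) (hw : ∀ i j, 0 ≤ w i j) (s : ι → ℝ) (r : κ → ℝ)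
    (hs : ∀ i, ∑ j, w i j = s i) (hr : ∀ j, ∑ i, w i j = r j)
    (hs1 : ∑ i, s i = 1) (hr1 : ∑ j, r j = 1)
    (sn : ℕ → ι → ℝ) (rn : ℕ → κ → ℝ) (hsn : ∀ n, ∑ i, sn n i = 1) (hrn : ∀ n, ∑ j, rn n j = 1)
    (hslim : ∀ i, Tendsto (fun n => sn n i) atTop (nhds (s i)))
    (hrlim : ∀ j, Tendsto (fun n => rn n j) atTop (nhds (r j)))
    (δ : ℝ) (hδ : 0 < δ) (hδ1 : δ ≤ 1) :
    ∃ (c : ι → κ → ℝ) (cn : ℕ → ι → κ → ℝ),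
      (∀ i j, Tendsto (fun n => cn n i j) atTop (nhds (c i j))) ∧
      (∀ᶠ n in atTop, ∀ i j, 0 ≤ cn n i j) ∧
      (∀ n i, ∑ j, cn n i j * rn n j = 1) ∧
      (∀ n j, ∑ i, cn n i j * sn n i = 1) ∧
      (∀ i j, c i j * (s i * r j) = (1 - δ) * w i j + δ * (s i * r j)) ∧
      (∀ i j, s i * r j * KLphi (c i j) ≤ s i * r j * KLphi (w i j / (s i * r j))) := by
  have hs0 : ∀ i, 0 ≤ s i := fun i => hs i ▸ sum_nonneg fun j _ => hw i j
  have hr0 : ∀ j, 0 ≤ r j := fun j => hr j ▸ sum_nonneg fun i _ => hw i j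
  have hws : ∀ i j, w i j ≤ s i := fun i j =>
    hs i ▸ single_le_sum (f := fun j => w i j) (fun j _ => hw i j) (mem_univ j)
  have hwr : ∀ i j, w i j ≤ r j := fun i j =>
    hr j ▸ single_le_sum (f := fun i => w i j) (fun i _ => hw i j) (mem_univ i)
  have hw_zero : ∀ i j, s i * r j = 0 → w i j = 0 := by
    intro i j h
    rcases mul_eq_zero.1 h with h | h
    · exact le_antisymm (h ▸ hws i j) (hw i j)
    · exact le_antisymm (h ▸ hwr i j) (hw i j)
  set b : ι → κ → ℝ := fun i j => if s i * r j = 0 then 1 else w i j / (s i * r j) with hb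
  have hb0 : ∀ i j, 0 ≤ b i j := by
    intro i j
    simp only [hb]
    split_ifs
    · exact zero_le_one
    · exact div_nonneg (hw i j) (mul_nonneg (hs0 i) (hr0 j))
  have hbw : ∀ i j, b i j * (s i * r j) = w i j := by
    intro i j
    simp only [hb]
    split_ifs with h
    · rw [h, hw_zero i j h, mul_zero]
    · exact div_mul_cancel₀ _ h
  have hb_row : ∀ i, ∑ j, b i j * r j = 1 := by
    intro i
    by_cases h : s i = 0
    · simpa [hb, h] using hr1
    · apply mul_left_cancel₀ h
      rw [mul_one, mul_sum]
      exact (sum_congr rfl fun j _ => by rw [← hbw i j]; ring).trans (hs i)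
  have hb_col : ∀ j, ∑ i, b i j * s i = 1 := by
    intro j
    by_cases h : r j = 0
    · simpa [hb, h] using hs1
    · apply mul_left_cancel₀ h
      rw [mul_one, mul_sum]
      exact (sum_congr rfl fun i _ => by rw [← hbw i j]; ring).trans (hr j)
  set c : ι → κ → ℝ := fun i j => (1 - δ) * b i j + δ with hc
  have hcδ : ∀ i j, δ ≤ c i j := fun i j => by
    have := mul_nonneg (sub_nonneg.2 hδ1) (hb0 i j)
    simp only [hc]; linarith
  have hc_row : ∀ i, ∑ j, c i j * r j = 1 := by
    intro i
    simp only [hc, add_mul, sum_add_distrib, mul_assoc, ← mul_sum, hb_row, hr1]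
    ring
  have hc_col : ∀ j, ∑ i, c i j * s i = 1 := by
    intro j
    simp only [hc, add_mul, sum_add_distrib, mul_assoc, ← mul_sum, hb_col, hs1]
    ring
  set R : ℕ → ι → ℝ := fun n i => ∑ j, c i j * rn n j with hR
  set S : ℕ → κ → ℝ := fun n j => ∑ i, c i j * sn n i with hS
  set T : ℕ → ℝ := fun n => ∑ i, R n i * sn n i with hT
  have hT' : ∀ n, T n = ∑ j, S n j * rn n j := by
    intro n
    simp only [hT, hR, hS, sum_mul]
    rw [sum_comm]
    exact sum_congr rfl fun _ _ => sum_congr rfl fun _ _ => by ring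
  have hRlim : ∀ i, Tendsto (fun n => R n i) atTop (nhds 1) := by
    intro i
    rw [← hc_row i]
    exact tendsto_finsetSum _ fun j _ => (hrlim j).const_mul _
  have hSlim : ∀ j, Tendsto (fun n => S n j) atTop (nhds 1) := by
    intro j
    rw [← hc_col j]
    exact tendsto_finsetSum _ fun i _ => (hslim i).const_mul _
  have hTlim : Tendsto T atTop (nhds 1) := by
    have := tendsto_finsetSum univ fun i _ => (hRlim i).mul (hslim i)
    simpa only [one_mul, hs1] using this
  have hlim : ∀ i j, Tendsto (fun n => c i j + (1 - R n i) + (1 - S n j) - (1 - T n)) atTop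
      (nhds (c i j)) := by
    intro i j
    have := ((tendsto_const_nhds (x := c i j)).add ((hRlim i).const_sub 1)).add
      ((hSlim j).const_sub 1) |>.sub (hTlim.const_sub 1)
    simpa using this
  refine ⟨c, fun n i j => c i j + (1 - R n i) + (1 - S n j) - (1 - T n), hlim, ?_, ?_, ?_, ?_, ?_⟩
  · refine eventually_all.2 fun i => eventually_all.2 fun j => ?_
    exact (hlim i j).eventually_const_le (hδ.trans_le (hcδ i j))
  · intro n i
    simp only [add_mul, sub_mul, sum_add_distrib, sum_sub_distrib, ← mul_sum, hrn, ← hT' n]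
    simp only [hR]
    ring
  · intro n j
    have : ∑ i, R n i * sn n i = T n := rfl
    simp only [add_mul, sub_mul, sum_add_distrib, sum_sub_distrib, ← mul_sum, hsn, this]
    simp only [hS]
    ring
  · intro i j
    simp only [hc, add_mul, mul_assoc]
    rw [hbw]
  · intro i j
    by_cases h : s i * r j = 0
    · simp [h]
    · refine mul_le_mul_of_nonneg_left ?_ (mul_nonneg (hs0 i) (hr0 j))
      have hbe : b i j = w i j / (s i * r j) := by simp only [hb, if_neg h]
      rw [← hbe]
      have := convexOn_KLphi.2 (mem_Ici.2 (hb0 i j)) (mem_Ici.2 zero_le_one)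
        (sub_nonneg.2 hδ1) hδ.le (by ring)
      have h1 : KLphi 1 = 0 := by simp [KLphi]
      have h2 : 0 ≤ KLphi (b i j) := KLphi_nonneg (hb0 i j)
      simp only [smul_eq_mul, mul_one, h1, mul_zero, add_zero] at this
      simp only [hc]
      nlinarith
theorem integrable_of_nonneg_of_le_one {X : Type*} [MeasurableSpace X] {ν : Measure X}
    [IsFiniteMeasure ν] {f : X → ℝ} (hf : Measurable f) (h0 : ∀ x, 0 ≤ f x) (h1 : ∀ x, f x ≤ 1) :
    Integrable f ν :=
  Integrable.of_bound hf.aestronglyMeasurable 1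
    (Eventually.of_forall fun x => by rw [Real.norm_of_nonneg (h0 x)]; exact h1 x)

/-- Jensen's inequality for `KLphi` with respect to a bounded weight. -/
theorem integral_mul_KLphi_le {X : Type*} [MeasurableSpace X] {π : Measure X} [IsFiniteMeasure π]
    {w f : X → ℝ} (hw : Measurable w) (hw0 : ∀ x, 0 ≤ w x) (hw1 : ∀ x, w x ≤ 1)
    (hf0 : ∀ x, 0 ≤ f x) (hf : Integrable f π) (hφ : Integrable (fun x => KLphi (f x)) π) :
    (∫ x, w x ∂π) * KLphi ((∫ x, w x * f x ∂π) / ∫ x, w x ∂π) ≤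
      ∫ x, w x * KLphi (f x) ∂π := by
  rcases eq_or_lt_of_le (integral_nonneg hw0 : (0 : ℝ) ≤ ∫ x, w x ∂π) with hm | hm
  · rw [← hm, zero_mul]
    exact integral_nonneg fun x => mul_nonneg (hw0 x) (KLphi_nonneg (hf0 x))
  set μ : Measure X := π.withDensity fun x => ENNReal.ofReal (w x) with hμ
  have hμπ : μ ≤ π := by
    calc μ ≤ π.withDensity 1 :=
          withDensity_mono (Eventually.of_forall fun x => by simpa using hw1 x)
      _ = π := withDensity_one
  have : IsFiniteMeasure μ := isFiniteMeasure_of_le π hμπ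
  have hint : ∀ h : X → ℝ, ∫ x, h x ∂μ = ∫ x, w x * h x ∂π := by
    intro h
    rw [hμ, integral_withDensity_eq_integral_toReal_smul hw.ennreal_ofReal
      (Eventually.of_forall fun x => ENNReal.ofReal_lt_top)]
    simp only [ENNReal.toReal_ofReal (hw0 _), smul_eq_mul]
  have hmass : μ.real univ = ∫ x, w x ∂π := by
    have := hint fun _ => 1
    simpa using this
  have hne : NeZero μ := ⟨fun h => by simp [h] at hmass; exact hm.ne hmass⟩
  have hJ := convexOn_KLphi.map_average_le (μ := μ) (f := f) continuous_KLphi.continuousOn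
    isClosed_Ici (Eventually.of_forall hf0) (hf.mono_measure hμπ) (hφ.mono_measure hμπ)
  rw [average_eq, average_eq, hint, hint, hmass, smul_eq_mul, smul_eq_mul] at hJ
  rw [div_eq_inv_mul]
  calc _ ≤ (∫ x, w x ∂π) * ((∫ x, w x ∂π)⁻¹ * ∫ x, w x * KLphi (f x) ∂π) :=
        mul_le_mul_of_nonneg_left hJ hm.le
    _ = _ := by rw [mul_inv_cancel_left₀ hm.ne']

/-- Data processing inequality for `KL` under a finite partition of unity. -/
theorem ofReal_sum_KLphi_le_KL {X ι : Type*} [MeasurableSpace X] [Fintype ι] (l π : Measure X)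
    [IsFiniteMeasure l] [IsFiniteMeasure π] {w : ι → X → ℝ} (hw : ∀ i, Measurable (w i))
    (hw0 : ∀ i x, 0 ≤ w i x) (hw1 : ∀ i x, w i x ≤ 1) (hsum : ∀ᵐ x ∂π, ∑ i, w i x = 1) :
    ENNReal.ofReal (∑ i, (∫ x, w i x ∂π) *
      KLphi ((∫ x, w i x ∂l) / ∫ x, w i x ∂π)) ≤ KL l π := by
  rw [KL]
  split_ifs with hac
  swap
  · exact le_top
  set f : X → ℝ := fun x => (l.rnDeriv π x).toReal with hf
  have hf0 : ∀ x, 0 ≤ f x := fun x => ENNReal.toReal_nonneg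
  have hφ0 : ∀ x, 0 ≤ KLphi (f x) := fun x => KLphi_nonneg (hf0 x)
  by_cases htop : ∫⁻ x, ENNReal.ofReal (KLphi (f x)) ∂π = ⊤
  · rw [htop]; exact le_top
  have hfm : Measurable f := (Measure.measurable_rnDeriv l π).ennreal_toReal
  have hφ : Integrable (fun x => KLphi (f x)) π := by
    refine ⟨(continuous_KLphi.measurable.comp hfm).aestronglyMeasurable, ?_⟩
    rw [hasFiniteIntegral_iff_ofReal (Eventually.of_forall hφ0)]
    exact lt_top_iff_ne_top.2 htop
  rw [← ofReal_integral_eq_lintegral_ofReal hφ (Eventually.of_forall hφ0)]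
  apply ENNReal.ofReal_le_ofReal
  have hwφ : ∀ i, Integrable (fun x => w i x * KLphi (f x)) π := fun i =>
    hφ.bdd_mul (c := 1) (hw i).aestronglyMeasurable (Eventually.of_forall fun x => by
      rw [Real.norm_of_nonneg (hw0 i x)]; exact hw1 i x)
  calc _ ≤ ∑ i, ∫ x, w i x * KLphi (f x) ∂π := by
        refine Finset.sum_le_sum fun i _ => ?_
        have hl : ∫ x, w i x ∂l = ∫ x, w i x * f x ∂π := by
          rw [← integral_toReal_rnDeriv_mul hac]
          simp only [hf, mul_comm]
        rw [hl]
        exact integral_mul_KLphi_le (hw i) (hw0 i) (hw1 i) hf0 Measure.integrable_toReal_rnDeriv hφ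
    _ = ∫ x, KLphi (f x) ∂π := by
        rw [← integral_finsetSum _ fun i _ => hwφ i]
        refine integral_congr_ae (hsum.mono fun x hx => ?_)
        simp only [← Finset.sum_mul, hx, one_mul]

theorem KL_withDensity_sum_le {X ι : Type*} [MeasurableSpace X] [Fintype ι] (π : Measure X)
    [IsFiniteMeasure π] {w : ι → X → ℝ} (hw : ∀ i, Measurable (w i))
    (hw0 : ∀ i x, 0 ≤ w i x) (hw1 : ∀ i x, w i x ≤ 1) (hsum : ∀ᵐ x ∂π, ∑ i, w i x = 1)
    {c : ι → ℝ} (hc : ∀ i, 0 ≤ c i) :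
    KL (π.withDensity fun x => ENNReal.ofReal (∑ i, c i * w i x)) π ≤
      ENNReal.ofReal (∑ i, (∫ x, w i x ∂π) * KLphi (c i)) := by
  have hm : Measurable fun x => ENNReal.ofReal (∑ i, c i * w i x) :=
    (Finset.measurable_sum _ fun i _ => (hw i).const_mul _).ennreal_ofReal
  have hwi : ∀ i, Integrable (w i) π := fun i =>
    integrable_of_nonneg_of_le_one (hw i) (hw0 i) (hw1 i)
  rw [KL, if_pos (withDensity_absolutelyContinuous _ _)]
  calc _ ≤ ∫⁻ x, ENNReal.ofReal (∑ i, w i x * KLphi (c i)) ∂π := by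
        refine lintegral_mono_ae ?_
        filter_upwards [Measure.rnDeriv_withDensity π hm, hsum] with x hx hs
        rw [hx, ENNReal.toReal_ofReal
          (Finset.sum_nonneg fun i _ => mul_nonneg (hc i) (hw0 i x))]
        apply ENNReal.ofReal_le_ofReal
        have := convexOn_KLphi.map_sum_le (t := Finset.univ) (w := fun i => w i x) (p := c)
          (fun i _ => hw0 i x) hs (fun i _ => hc i)
        simpa only [smul_eq_mul, mul_comm (w _ x)] using this
    _ = ENNReal.ofReal (∫ x, ∑ i, w i x * KLphi (c i) ∂π) := by
        rw [ofReal_integral_eq_lintegral_ofReal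
          (integrable_finsetSum _ fun i _ => (hwi i).mul_const _)
          (Eventually.of_forall fun x => Finset.sum_nonneg fun i _ =>
            mul_nonneg (hw0 i x) (KLphi_nonneg (hc i)))]
    _ = _ := by
        rw [integral_finsetSum _ fun i _ => (hwi i).mul_const _]
        simp only [integral_mul_const]

/-- Integrating against a weight supported where `h` is close to `a` amounts to multiplying by
`a`, up to the oscillation of `h`. -/
theorem abs_integral_mul_sub_le {X : Type*} [MeasurableSpace X] {ν : Measure X}
    {h w : X → ℝ} (hw : Integrable w ν) (hh : AEStronglyMeasurable h ν) (hw0 : ∀ x, 0 ≤ w x)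
    {a ω : ℝ} (hosc : ∀ᵐ x ∂ν, w x ≠ 0 → |h x - a| ≤ ω) :
    Integrable (fun x => w x * h x) ν ∧
      |∫ x, w x * h x ∂ν - (∫ x, w x ∂ν) * a| ≤ (∫ x, w x ∂ν) * ω := by
  have hb : ∀ᵐ x ∂ν, ‖w x * (h x - a)‖ ≤ w x * ω := by
    filter_upwards [hosc] with x hx
    rw [norm_mul, Real.norm_of_nonneg (hw0 x)]
    by_cases h0 : w x = 0
    · simp [h0]
    · exact mul_le_mul_of_nonneg_left (hx h0) (hw0 x)
  have hi : Integrable (fun x => w x * (h x - a)) ν :=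
    (hw.mul_const ω).mono' (hw.aestronglyMeasurable.mul (hh.sub aestronglyMeasurable_const)) hb
  have heq : (fun x => w x * h x) = fun x => w x * (h x - a) + w x * a := by
    ext x; ring
  refine ⟨heq ▸ hi.add (hw.mul_const a), ?_⟩
  rw [heq, integral_add hi (hw.mul_const a), integral_mul_const, add_sub_cancel_right,
    ← integral_mul_const ω, ← Real.norm_eq_abs]
  exact norm_integral_le_of_norm_le (hw.mul_const ω) hb

theorem exists_finite_partitionOfUnity_subordinate_balls {X : Type*} [MetricSpace X] {s : Set X}
    (hs : IsCompact s) {ε : ℝ} (hε : 0 < ε) :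
    ∃ (t : Finset X) (φ : t → X → ℝ), (∀ i, Continuous (φ i)) ∧ (∀ i x, 0 ≤ φ i x) ∧
      (∀ i x, φ i x ≤ 1) ∧ (∀ x ∈ s, ∑ i, φ i x = 1) ∧ (∀ i : t, (i : X) ∈ s) ∧
      (∀ (i : t) x, φ i x ≠ 0 → dist x (i : X) < ε) := by
  obtain ⟨t, hts, htf, hcov⟩ := hs.finite_cover_balls hε
  obtain ⟨f, hf⟩ := PartitionOfUnity.exists_isSubordinate hs.isClosed
    (fun i : htf.toFinset => Metric.ball (i : X) ε) (fun i => Metric.isOpen_ball) (by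
      intro x hx
      obtain ⟨i, hi, hxi⟩ := mem_iUnion₂.1 (hcov hx)
      exact mem_iUnion.2 ⟨⟨i, htf.mem_toFinset.2 hi⟩, hxi⟩)
  refine ⟨htf.toFinset, fun i => f i, fun i => (f i).continuous, f.nonneg, f.le_one, ?_,
    fun i => hts (htf.mem_toFinset.1 i.2), fun i x hx => hf i (subset_tsupport _ hx)⟩
  intro x hx
  rw [← finsum_eq_sum_of_fintype]
  exact f.sum_eq_one hx

theorem abs_integral_sum_mul_sub_le {X ι : Type*} [MeasurableSpace X] [Fintype ι] {ν : Measure X}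
    {h : X → ℝ} {w : ι → X → ℝ} (hw : ∀ i, Integrable (w i) ν) (hh : AEStronglyMeasurable h ν)
    (hw0 : ∀ i x, 0 ≤ w i x) {c a : ι → ℝ} (hc : ∀ i, 0 ≤ c i) {ω : ℝ}
    (hosc : ∀ i, ∀ᵐ x ∂ν, w i x ≠ 0 → |h x - a i| ≤ ω) :
    |∫ x, (∑ i, c i * w i x) * h x ∂ν - ∑ i, c i * (∫ x, w i x ∂ν) * a i| ≤
      (∑ i, c i * ∫ x, w i x ∂ν) * ω := by
  have key := fun i => abs_integral_mul_sub_le (hw i) hh (hw0 i) (hosc i)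
  have heq : ∫ x, (∑ i, c i * w i x) * h x ∂ν = ∑ i, c i * ∫ x, w i x * h x ∂ν := by
    simp only [Finset.sum_mul, mul_assoc]
    rw [integral_finsetSum _ fun i _ => (key i).1.const_mul (c i)]
    simp only [integral_const_mul]
  rw [heq, ← Finset.sum_sub_distrib, Finset.sum_mul]
  refine (Finset.abs_sum_le_sum_abs _ _).trans (Finset.sum_le_sum fun i _ => ?_)
  rw [mul_assoc, ← mul_sub, abs_mul, abs_of_nonneg (hc i), mul_assoc]
  exact mul_le_mul_of_nonneg_left (key i).2 (hc i)

theorem map_fst_withDensity_prod {A B : Type*} [MeasurableSpace A] [MeasurableSpace B]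
    {σ : Measure A} {ρ : Measure B} [SFinite σ] [SFinite ρ] {F : A × B → ℝ≥0∞}
    (hF : Measurable F) (h : ∀ᵐ x ∂σ, ∫⁻ y, F (x, y) ∂ρ = 1) :
    ((σ.prod ρ).withDensity F).map Prod.fst = σ := by
  ext s hs
  rw [Measure.map_apply measurable_fst hs, withDensity_apply _ (measurable_fst hs),
    ← lintegral_indicator (measurable_fst hs),
    lintegral_prod _ (hF.indicator (measurable_fst hs)).aemeasurable,
    ← lintegral_indicator_one hs]
  refine lintegral_congr_ae (h.mono fun x hx => ?_)
  by_cases hxs : x ∈ s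
  · simpa [indicator, hxs] using hx
  · simp [indicator, hxs]

theorem map_snd_withDensity_prod {A B : Type*} [MeasurableSpace A] [MeasurableSpace B]
    {σ : Measure A} {ρ : Measure B} [SFinite σ] [SFinite ρ] {F : A × B → ℝ≥0∞}
    (hF : Measurable F) (h : ∀ᵐ y ∂ρ, ∫⁻ x, F (x, y) ∂σ = 1) :
    ((σ.prod ρ).withDensity F).map Prod.snd = ρ := by
  ext s hs
  rw [Measure.map_apply measurable_snd hs, withDensity_apply _ (measurable_snd hs),
    ← lintegral_indicator (measurable_snd hs),
    lintegral_prod_symm _ (hF.indicator (measurable_snd hs)).aemeasurable,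
    ← lintegral_indicator_one hs]
  refine lintegral_congr_ae (h.mono fun x hx => ?_)
  by_cases hxs : x ∈ s
  · simpa [indicator, hxs] using hx
  · simp [indicator, hxs]

theorem ae_mem_prod_of_map_fst_of_map_snd {A B : Type*} [MeasurableSpace A] [MeasurableSpace B]
    {μ : Measure (A × B)} {σ : Measure A} {ρ : Measure B} {Z : Set A} {Y : Set B}
    (h1 : μ.map Prod.fst = σ) (h2 : μ.map Prod.snd = ρ) (hσ : ∀ᵐ x ∂σ, x ∈ Z)
    (hρ : ∀ᵐ y ∂ρ, y ∈ Y) : ∀ᵐ p ∂μ, p ∈ Z ×ˢ Y := by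
  subst h1 h2
  filter_upwards [ae_of_ae_map measurable_fst.aemeasurable hσ,
    ae_of_ae_map measurable_snd.aemeasurable hρ] with p hp1 hp2
  exact ⟨hp1, hp2⟩

/-- Quantitative weak* closeness of two measures on `K`. -/
def WkClose {X : Type*} [MeasurableSpace X] [PseudoMetricSpace X] (K : Set X) (ε : ℝ)
    (μ ν : Measure X) : Prop :=
  ∀ h : X → ℝ, Continuous h → ∀ M ω : ℝ, (∀ p ∈ K, |h p| ≤ M) →
    (∀ p ∈ K, ∀ q ∈ K, dist p q < ε → |h p - h q| ≤ ω) →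
    |∫ x, h x ∂μ - ∫ x, h x ∂ν| ≤ 2 * ω + 3 * ε * M

/-- Every coupling can be approximated by couplings of the approximating marginals with bounded
density, whose entropy is asymptotically at most that of the given coupling. -/
theorem exists_eventually_coupling_wkClose {A B : Type*}
    [MetricSpace A] [MeasurableSpace A] [BorelSpace A] [SecondCountableTopology A]
    [MetricSpace B] [MeasurableSpace B] [BorelSpace B] [SecondCountableTopology B]
    {Z : Set A} {Y : Set B} (hZ : IsCompact Z) (hY : IsCompact Y)
    {σs : ℕ → Measure A} {σ : Measure A} {ρs : ℕ → Measure B} {ρ : Measure B}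
    [∀ n, IsProbabilityMeasure (σs n)] [IsProbabilityMeasure σ]
    [∀ n, IsProbabilityMeasure (ρs n)] [IsProbabilityMeasure ρ]
    (hσsZ : ∀ n, ∀ᵐ x ∂σs n, x ∈ Z) (hσZ : ∀ᵐ x ∂σ, x ∈ Z) (hσ : WkTendsto σs σ)
    (hρsY : ∀ n, ∀ᵐ y ∂ρs n, y ∈ Y) (hρY : ∀ᵐ y ∂ρ, y ∈ Y) (hρ : WkTendsto ρs ρ)
    (l : Measure (A × B)) [IsProbabilityMeasure l]
    (hl1 : l.map Prod.fst = σ) (hl2 : l.map Prod.snd = ρ) {ε : ℝ} (hε : 0 < ε) (hε1 : ε ≤ 1) :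
    ∃ C : ℝ, 0 ≤ C ∧ ENNReal.ofReal C ≤ KL l (σ.prod ρ) ∧ ∀ᶠ n in atTop,
      ∃ μ : Measure (A × B), μ.map Prod.fst = σs n ∧ μ.map Prod.snd = ρs n ∧
        WkClose (Z ×ˢ Y) ε μ l ∧ KL μ ((σs n).prod (ρs n)) ≤ ENNReal.ofReal (C + ε) := by
  obtain ⟨t, φ, hφc, hφ0, hφ1, hφs, htZ, hφd⟩ :=
    exists_finite_partitionOfUnity_subordinate_balls hZ hε
  obtain ⟨u, ψ, hψc, hψ0, hψ1, hψs, huY, hψd⟩ :=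
    exists_finite_partitionOfUnity_subordinate_balls hY hε
  set w : t × u → A × B → ℝ := fun a p => φ a.1 p.1 * ψ a.2 p.2 with hw
  have hwc : ∀ a, Continuous (w a) := fun a =>
    ((hφc a.1).comp continuous_fst).mul ((hψc a.2).comp continuous_snd)
  have hwm : ∀ a, Measurable (w a) := fun a => (hwc a).measurable
  have hw0 : ∀ a p, 0 ≤ w a p := fun a p => mul_nonneg (hφ0 _ _) (hψ0 _ _)
  have hw1 : ∀ a p, w a p ≤ 1 := fun a p => mul_le_one₀ (hφ1 _ _) (hψ0 _ _) (hψ1 _ _)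
  have hws : ∀ p ∈ Z ×ˢ Y, ∑ a, w a p = 1 := by
    intro p hp
    simp only [hw, Fintype.sum_prod_type, ← Finset.mul_sum, hψs _ hp.2, mul_one, hφs _ hp.1]
  have bintA : ∀ (ν : Measure A) [IsFiniteMeasure ν] i, Integrable (φ i) ν := fun ν _ i =>
    integrable_of_nonneg_of_le_one (hφc i).measurable (hφ0 i) (hφ1 i)
  have bintB : ∀ (ν : Measure B) [IsFiniteMeasure ν] j, Integrable (ψ j) ν := fun ν _ j =>
    integrable_of_nonneg_of_le_one (hψc j).measurable (hψ0 j) (hψ1 j)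
  have bintw : ∀ (ν : Measure (A × B)) [IsFiniteMeasure ν] a, Integrable (w a) ν := fun ν _ a =>
    integrable_of_nonneg_of_le_one (hwm a) (hw0 a) (hw1 a)
  have hlK := ae_mem_prod_of_map_fst_of_map_snd hl1 hl2 hσZ hρY
  have sumA : ∀ (ν : Measure A) [IsProbabilityMeasure ν], (∀ᵐ x ∂ν, x ∈ Z) →
      ∑ i, ∫ x, φ i x ∂ν = 1 := by
    intro ν _ hν
    rw [← integral_finsetSum _ fun i _ => bintA ν i,
      integral_congr_ae (hν.mono fun x hx => hφs x hx)]
    simp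
  have sumB : ∀ (ν : Measure B) [IsProbabilityMeasure ν], (∀ᵐ x ∂ν, x ∈ Y) →
      ∑ i, ∫ x, ψ i x ∂ν = 1 := by
    intro ν _ hν
    rw [← integral_finsetSum _ fun i _ => bintB ν i,
      integral_congr_ae (hν.mono fun x hx => hψs x hx)]
    simp
  have hrow : ∀ i, ∑ j, ∫ p, w (i, j) p ∂l = ∫ x, φ i x ∂σ := by
    intro i
    rw [← integral_finsetSum _ fun j _ => bintw l (i, j), ← hl1,
      integral_map measurable_fst.aemeasurable (hφc i).measurable.aestronglyMeasurable]
    refine integral_congr_ae (hlK.mono fun p hp => ?_)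
    simp only [hw, ← Finset.mul_sum, hψs _ hp.2, mul_one]
  have hcol : ∀ j, ∑ i, ∫ p, w (i, j) p ∂l = ∫ y, ψ j y ∂ρ := by
    intro j
    rw [← integral_finsetSum _ fun i _ => bintw l (i, j), ← hl2,
      integral_map measurable_snd.aemeasurable (hψc j).measurable.aestronglyMeasurable]
    refine integral_congr_ae (hlK.mono fun p hp => ?_)
    simp only [hw, ← Finset.sum_mul, hφs _ hp.1, one_mul]
  have hl0 : ∀ a, 0 ≤ ∫ p, w a p ∂l := fun a => integral_nonneg (hw0 a)
  have hprod : ∀ (α : Measure A) (β : Measure B) [SFinite α] [SFinite β] a,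
      ∫ p, w a p ∂α.prod β = (∫ x, φ a.1 x ∂α) * ∫ y, ψ a.2 y ∂β :=
    fun α β _ _ a => integral_prod_mul (φ a.1) (ψ a.2)
  set s : t → ℝ := fun i => ∫ x, φ i x ∂σ with hs
  set r : u → ℝ := fun j => ∫ y, ψ j y ∂ρ with hr
  have hs0 : ∀ i, 0 ≤ s i := fun i => integral_nonneg (hφ0 i)
  have hr0 : ∀ j, 0 ≤ r j := fun j => integral_nonneg (hψ0 j)
  have hs1 : ∑ i, s i = 1 := sumA σ hσZ
  have hr1 : ∑ j, r j = 1 := sumB ρ hρY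
  have hslim : ∀ i, Tendsto (fun n => ∫ x, φ i x ∂σs n) atTop (nhds (s i)) :=
    fun i => hσ _ (hφc i)
  have hrlim : ∀ j, Tendsto (fun n => ∫ y, ψ j y ∂ρs n) atTop (nhds (r j)) :=
    fun j => hρ _ (hψc j)
  obtain ⟨c, cn, hlim, hpos, hcr, hcc, hmix, hent⟩ :=
    exists_tendsto_couplingDensity (fun i j => ∫ p, w (i, j) p ∂l) (fun i j => hl0 _) s r
      hrow hcol hs1 hr1 (fun n i => ∫ x, φ i x ∂σs n)
      (fun n j => ∫ y, ψ j y ∂ρs n) (fun n => sumA _ (hσsZ n)) (fun n => sumB _ (hρsY n))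
      hslim hrlim ε hε hε1
  have hl_sum : ∑ a, ∫ p, w a p ∂l = 1 := by
    rw [Fintype.sum_prod_type]
    exact (Finset.sum_congr rfl fun i _ => hrow i).trans hs1
  have hsr_sum : ∑ a : t × u, s a.1 * r a.2 = 1 := by
    rw [Fintype.sum_prod_type]
    simp only [← Finset.mul_sum, hr1, mul_one, hs1]
  have hπK := ae_mem_prod_of_map_fst_of_map_snd (μ := σ.prod ρ) (by simp) (by simp) hσZ hρY
  refine ⟨∑ a : t × u, s a.1 * r a.2 * KLphi ((∫ p, w a p ∂l) / (s a.1 * r a.2)), ?_, ?_, ?_⟩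
  · exact Finset.sum_nonneg fun a _ => mul_nonneg (mul_nonneg (hs0 _) (hr0 _))
      (KLphi_nonneg (div_nonneg (hl0 a) (mul_nonneg (hs0 _) (hr0 _))))
  · have := ofReal_sum_KLphi_le_KL l (σ.prod ρ) hwm hw0 hw1 (hπK.mono hws)
    simpa only [hprod] using this
  have hlim_ent : Tendsto (fun n => ∑ a : t × u,
      (∫ x, φ a.1 x ∂σs n) * (∫ y, ψ a.2 y ∂ρs n) * KLphi (cn n a.1 a.2)) atTop
      (nhds (∑ a : t × u, s a.1 * r a.2 * KLphi (c a.1 a.2))) :=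
    tendsto_finsetSum _ fun a _ => ((hslim a.1).mul (hrlim a.2)).mul
      ((continuous_KLphi.tendsto _).comp (hlim a.1 a.2))
  have hev_ent := hlim_ent.eventually_le_const (lt_add_of_le_of_pos
    (Finset.sum_le_sum fun a _ => hent a.1 a.2) hε)
  have hlim_dist : Tendsto (fun n => ∑ a : t × u, |cn n a.1 a.2 *
      ((∫ x, φ a.1 x ∂σs n) * ∫ y, ψ a.2 y ∂ρs n) - ∫ p, w a p ∂l|) atTop
      (nhds (∑ a : t × u, |c a.1 a.2 * (s a.1 * r a.2) - ∫ p, w a p ∂l|)) :=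
    tendsto_finsetSum _ fun a _ =>
      (((hlim a.1 a.2).mul ((hslim a.1).mul (hrlim a.2))).sub_const _).abs
  have hdist : ∑ a : t × u, |c a.1 a.2 * (s a.1 * r a.2) - ∫ p, w a p ∂l| < 3 * ε := by
    calc _ ≤ ∑ a : t × u, ε * (s a.1 * r a.2 + ∫ p, w a p ∂l) := by
          refine Finset.sum_le_sum fun a _ => ?_
          have h1 := mul_nonneg hε.le (mul_nonneg (hs0 a.1) (hr0 a.2))
          have h2 := mul_nonneg hε.le (hl0 a)
          rw [hmix, abs_le]
          constructor <;> linarith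
      _ = ε * 2 := by
          rw [← Finset.mul_sum, Finset.sum_add_distrib, hl_sum, hsr_sum]; norm_num
      _ < 3 * ε := by linarith
  have hev_dist := hlim_dist.eventually_le_const hdist
  filter_upwards [hpos, hev_ent, hev_dist] with n hc hE hD
  have hc' : ∀ a : t × u, 0 ≤ cn n a.1 a.2 := fun a => hc _ _
  set π := (σs n).prod (ρs n) with hπ
  have hπnK := ae_mem_prod_of_map_fst_of_map_snd (μ := π) (by simp [hπ]) (by simp [hπ])
    (hσsZ n) (hρsY n)
  set G : A × B → ℝ := fun p => ∑ a : t × u, cn n a.1 a.2 * w a p with hG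
  have hGm : Measurable G := Finset.measurable_sum _ fun a _ => (hwm a).const_mul _
  have hG0 : ∀ p, 0 ≤ G p := fun p =>
    Finset.sum_nonneg fun a _ => mul_nonneg (hc' a) (hw0 a p)
  refine ⟨π.withDensity fun p => ENNReal.ofReal (G p), ?_, ?_, ?_, ?_⟩
  · refine map_fst_withDensity_prod hGm.ennreal_ofReal ((hσsZ n).mono fun x hx => ?_)
    have hGx : ∀ y, G (x, y) = ∑ j, (∑ i, cn n i j * φ i x) * ψ j y := by
      intro y
      simp only [hG, hw, Fintype.sum_prod_type, Finset.sum_mul]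
      rw [Finset.sum_comm]
      exact Finset.sum_congr rfl fun _ _ => Finset.sum_congr rfl fun _ _ => by ring
    have hi : ∀ j, Integrable (fun y => (∑ i, cn n i j * φ i x) * ψ j y) (ρs n) :=
      fun j => (bintB _ j).const_mul _
    rw [← ofReal_integral_eq_lintegral_ofReal _ (Eventually.of_forall fun y => hG0 _)]
    · simp only [hGx]
      rw [integral_finsetSum _ fun j _ => hi j]
      simp only [integral_const_mul]
      simp only [Finset.sum_mul]
      rw [Finset.sum_comm, ENNReal.ofReal_eq_one, ← hφs x hx]
      refine Finset.sum_congr rfl fun i _ => ?_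
      refine Eq.trans ?_ (mul_one (φ i x))
      rw [← hcr n i, Finset.mul_sum]
      exact Finset.sum_congr rfl fun j _ => by ring
    · simp only [hGx]
      exact integrable_finsetSum _ fun j _ => hi j
  · refine map_snd_withDensity_prod hGm.ennreal_ofReal ((hρsY n).mono fun y hy => ?_)
    have hGy : ∀ x, G (x, y) = ∑ i, (∑ j, cn n i j * ψ j y) * φ i x := by
      intro x
      simp only [hG, hw, Fintype.sum_prod_type, Finset.sum_mul]
      exact Finset.sum_congr rfl fun _ _ => Finset.sum_congr rfl fun _ _ => by ring
    have hi : ∀ i, Integrable (fun x => (∑ j, cn n i j * ψ j y) * φ i x) (σs n) :=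
      fun i => (bintA _ i).const_mul _
    rw [← ofReal_integral_eq_lintegral_ofReal _ (Eventually.of_forall fun x => hG0 _)]
    · simp only [hGy]
      rw [integral_finsetSum _ fun i _ => hi i]
      simp only [integral_const_mul]
      simp only [Finset.sum_mul]
      rw [Finset.sum_comm, ENNReal.ofReal_eq_one, ← hψs y hy]
      refine Finset.sum_congr rfl fun j _ => ?_
      refine Eq.trans ?_ (mul_one (ψ j y))
      rw [← hcc n j, Finset.mul_sum]
      exact Finset.sum_congr rfl fun i _ => by ring
    · simp only [hGy]
      exact integrable_finsetSum _ fun i _ => hi i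
  · intro h hh M ω hM hω
    obtain ⟨q, hq⟩ := hlK.exists
    have hM0 : 0 ≤ M := (abs_nonneg _).trans (hM q hq)
    set P : t × u → A × B := fun a => (↑a.1, ↑a.2) with hP
    have hPK : ∀ a, P a ∈ Z ×ˢ Y := fun a => ⟨htZ _, huY _⟩
    have hosc : ∀ p ∈ Z ×ˢ Y, ∀ a, w a p ≠ 0 → |h p - h (P a)| ≤ ω := by
      intro p hp a ha
      refine hω p hp _ (hPK a) ?_
      rw [Prod.dist_eq, max_lt_iff]
      exact ⟨hφd _ _ (left_ne_zero_of_mul ha), hψd _ _ (right_ne_zero_of_mul ha)⟩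
    have h1 := abs_integral_sum_mul_sub_le (bintw l) hh.measurable.aestronglyMeasurable hw0
      (c := fun _ => 1) (a := fun a => h (P a)) (fun _ => zero_le_one) (ω := ω)
      (fun a => hlK.mono fun p hp => hosc p hp a)
    have h2 := abs_integral_sum_mul_sub_le (bintw π) hh.measurable.aestronglyMeasurable hw0
      (a := fun a => h (P a)) hc' (ω := ω) (fun a => hπnK.mono fun p hp => hosc p hp a)
    simp only [one_mul, hl_sum] at h1
    have h3 : ∫ p, (∑ a, w a p) * h p ∂l = ∫ p, h p ∂l :=
      integral_congr_ae (hlK.mono fun p hp => by simp only [hws p hp, one_mul])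
    have h4 : ∫ p, h p ∂π.withDensity (fun p => ENNReal.ofReal (G p)) = ∫ p, G p * h p ∂π := by
      rw [integral_withDensity_eq_integral_toReal_smul hGm.ennreal_ofReal
        (Eventually.of_forall fun x => ENNReal.ofReal_lt_top)]
      simp only [ENNReal.toReal_ofReal (hG0 _), smul_eq_mul]
    have h5 : ∑ a : t × u, cn n a.1 a.2 * ∫ p, w a p ∂π = 1 := by
      rw [← sumA _ (hσsZ n), Fintype.sum_prod_type]
      refine Finset.sum_congr rfl fun i _ => ?_
      rw [← one_mul (∫ x, φ i x ∂σs n), ← hcr n i, Finset.sum_mul]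
      exact Finset.sum_congr rfl fun j _ => by rw [hπ, hprod]; ring
    rw [h5, one_mul] at h2
    rw [h3] at h1
    have h6 : |∑ a : t × u, cn n a.1 a.2 * (∫ p, w a p ∂π) * h (P a) -
        ∑ a, (∫ p, w a p ∂l) * h (P a)| ≤ 3 * ε * M := by
      rw [← Finset.sum_sub_distrib]
      refine (Finset.abs_sum_le_sum_abs _ _).trans ?_
      refine le_trans ?_ (mul_le_mul_of_nonneg_right hD hM0)
      rw [Finset.sum_mul]
      refine Finset.sum_le_sum fun a _ => ?_
      rw [← sub_mul, abs_mul, hπ, hprod]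
      exact mul_le_mul_of_nonneg_left (hM _ (hPK a)) (abs_nonneg _)
    rw [h4]
    rw [abs_le] at h1 h2 h6 ⊢
    constructor <;> linarith
  · refine (KL_withDensity_sum_le π hwm hw0 hw1 (hπnK.mono hws) hc').trans ?_
    apply ENNReal.ofReal_le_ofReal
    simp only [hπ, hprod]
    exact hE

theorem exists_tendsto_atTop_eventually_diagonal {P : ℕ → ℕ → Prop}
    (h : ∀ k, ∀ᶠ n in atTop, P k n) :
    ∃ k : ℕ → ℕ, Tendsto k atTop atTop ∧ ∀ᶠ n in atTop, P (k n) n := by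
  refine ⟨fun n => Nat.findGreatest (fun k => P k n) n, ?_, ?_⟩
  · refine tendsto_atTop.2 fun K => ?_
    filter_upwards [h K, eventually_ge_atTop K] with n hn hK
    exact Nat.le_findGreatest hK hn
  · filter_upwards [h 0] with n hn
    exact Nat.findGreatest_spec (P := fun k => P k n) n.zero_le hn

theorem wkTendsto_of_wkClose {X : Type*} [MeasurableSpace X] [PseudoMetricSpace X] {K : Set X}
    (hK : IsCompact K) {μs : ℕ → Measure X} {μ : Measure X} {e : ℕ → ℝ}
    (he : Tendsto e atTop (nhds 0)) (hc : ∀ᶠ n in atTop, WkClose K (e n) (μs n) μ) :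
    WkTendsto μs μ := by
  intro h hh
  obtain ⟨M, hM⟩ := hK.exists_bound_of_continuousOn hh.continuousOn
  rw [Metric.tendsto_nhds]
  intro τ hτ
  obtain ⟨δ, hδ, hu⟩ := Metric.uniformContinuousOn_iff.1
    (hK.uniformContinuousOn_of_continuous hh.continuousOn) (τ / 4) (by positivity)
  have hlim : Tendsto (fun n => 3 * e n * M) atTop (nhds 0) := by
    simpa using (he.const_mul 3).mul_const M
  filter_upwards [hc, he.eventually_lt_const hδ,
    hlim.eventually_lt_const (show 0 < τ / 4 by positivity)] with n hn heδ hen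
  have := hn h hh M (τ / 4) hM fun p hp q hq hpq => (hu p hp q hq (hpq.trans heδ)).le
  rw [Real.dist_eq]
  linarith

theorem integrable_of_continuous_of_ae_mem_isCompact {X : Type*} [MeasurableSpace X]
    [TopologicalSpace X] [BorelSpace X] {K : Set X} (hK : IsCompact K) {ν : Measure X}
    [IsFiniteMeasure ν] (hν : ∀ᵐ x ∂ν, x ∈ K) {h : X → ℝ} (hh : Continuous h) :
    Integrable h ν := by
  obtain ⟨M, hM⟩ := hK.exists_bound_of_continuousOn hh.continuousOn
  exact Integrable.of_bound hh.measurable.aestronglyMeasurable M (hν.mono hM)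

theorem tendsto_integral_of_tendstoUniformly_of_wkTendsto {X : Type*} [MeasurableSpace X]
    [TopologicalSpace X] [BorelSpace X] {K : Set X} (hK : IsCompact K) {μs : ℕ → Measure X}
    {μ : Measure X} [∀ n, IsProbabilityMeasure (μs n)] (hμK : ∀ n, ∀ᵐ x ∂μs n, x ∈ K)
    (hμ : WkTendsto μs μ) {gs : ℕ → X → ℝ} {g : X → ℝ} (hgs : ∀ n, Continuous (gs n))
    (hg : Continuous g) (hgu : TendstoUniformly gs g atTop) :
    Tendsto (fun n => ∫ x, gs n x ∂μs n) atTop (nhds (∫ x, g x ∂μ)) := by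
  have hdiff : Tendsto (fun n => ∫ x, gs n x ∂μs n - ∫ x, g x ∂μs n) atTop (nhds 0) := by
    rw [Metric.tendsto_nhds]
    intro τ hτ
    filter_upwards [Metric.tendstoUniformly_iff.1 hgu (τ / 2) (half_pos hτ)] with n hn
    rw [dist_zero_right, ← integral_sub
      (integrable_of_continuous_of_ae_mem_isCompact hK (hμK n) (hgs n))
      (integrable_of_continuous_of_ae_mem_isCompact hK (hμK n) hg)]
    have := norm_integral_le_of_norm_le_const (μ := μs n) (f := fun x => gs n x - g x)
      (C := τ / 2) (Eventually.of_forall fun x => by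
        rw [← dist_eq_norm, dist_comm]; exact (hn x).le)
    rw [probReal_univ, mul_one] at this
    linarith
  simpa using hdiff.add (hμ g hg)

theorem eventually_mul_coe_ennreal_le {ηs : ℕ → ℝ} {η : ℝ} (hηs : ∀ n, 0 ≤ ηs n) (hη : 0 ≤ η)
    (hηlim : Tendsto ηs atTop (nhds η)) {C ε : ℝ} (hC : 0 ≤ C) (hε : 0 < ε) {L : ℝ≥0∞}
    (hL : ENNReal.ofReal C ≤ L) :
    ∀ᶠ n in atTop, ∀ x : ℝ≥0∞, x ≤ ENNReal.ofReal (C + ε) →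
      (ηs n : EReal) * (x : EReal) ≤ (η : EReal) * (L : EReal) + ((ε * (η + 1) : ℝ) : EReal) := by
  have hlim : Tendsto (fun n => ηs n * (C + ε)) atTop (nhds (η * (C + ε))) := hηlim.mul_const _
  filter_upwards [hlim.eventually_le_const
    (show η * (C + ε) < η * C + ε * (η + 1) by linarith)] with n hn x hx
  have hx' : (x : EReal) ≤ ((C + ε : ℝ) : EReal) := by
    have := EReal.coe_ennreal_le_coe_ennreal_iff.2 hx
    rwa [EReal.coe_ennreal_ofReal, max_eq_left (by positivity)] at this
  have hL' : (C : EReal) ≤ (L : EReal) := by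
    have := EReal.coe_ennreal_le_coe_ennreal_iff.2 hL
    rwa [EReal.coe_ennreal_ofReal, max_eq_left hC] at this
  calc (ηs n : EReal) * (x : EReal) ≤ (ηs n : EReal) * ((C + ε : ℝ) : EReal) :=
        mul_le_mul_of_nonneg_left hx' (EReal.coe_nonneg.2 (hηs n))
    _ = ((ηs n * (C + ε) : ℝ) : EReal) := (EReal.coe_mul _ _).symm
    _ ≤ ((η * C + ε * (η + 1) : ℝ) : EReal) := EReal.coe_le_coe_iff.2 hn
    _ = (η : EReal) * (C : EReal) + ((ε * (η + 1) : ℝ) : EReal) := by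
        rw [EReal.coe_add, EReal.coe_mul]
    _ ≤ _ := add_le_add_left (mul_le_mul_of_nonneg_left hL' (EReal.coe_nonneg.2 hη)) _

/-- Γ-limsup (recovery sequence) inequality for the rescaled entropic cell
problems.  Given `gⁿ → g` uniformly, `ηⁿ → η ∈ [0,∞)`, weakly* convergent marginals
`σⁿ → σ` (on the compact `Z`), `ρⁿ → ρ` (on the compact `Y`), and `λ ∈ Π(σ, ρ)`, there are
couplings `λⁿ ∈ Π(σⁿ, ρⁿ)` with `λⁿ → λ` weakly* and
`limsup (∫ gⁿ dλⁿ + ηⁿ·KL(λⁿ|σⁿ⊗ρⁿ)) ≤ ∫ g dλ + η·KL(λ|σ⊗ρ)`. -/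
theorem stmt7 (d₁ d₂ : ℕ) (Z : Set (E d₁)) (Y : Set (E d₂))
    (hZ : IsCompact Z) (hY : IsCompact Y)
    (gs : ℕ → E d₁ × E d₂ → ℝ) (g : E d₁ × E d₂ → ℝ)
    (hgc : ∀ n, Continuous (gs n)) (hg : Continuous g)
    (hgu : TendstoUniformly gs g atTop)
    (ηs : ℕ → ℝ) (η : ℝ) (hηs : ∀ n, 0 ≤ ηs n) (hη : 0 ≤ η)
    (hηlim : Tendsto ηs atTop (nhds η))
    (σs : ℕ → Measure (E d₁)) (σ : Measure (E d₁))
    [∀ n, IsProbabilityMeasure (σs n)] [IsProbabilityMeasure σ]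
    (hσZ : ∀ n, σs n Zᶜ = 0) (hσZ' : σ Zᶜ = 0) (hσ : WkTendsto σs σ)
    (ρs : ℕ → Measure (E d₂)) (ρ : Measure (E d₂))
    [∀ n, IsProbabilityMeasure (ρs n)] [IsProbabilityMeasure ρ]
    (hρY : ∀ n, ρs n Yᶜ = 0) (hρY' : ρ Yᶜ = 0) (hρ : WkTendsto ρs ρ)
    (l : Measure (E d₁ × E d₂)) [IsProbabilityMeasure l]
    (hl1 : l.map Prod.fst = σ) (hl2 : l.map Prod.snd = ρ) :
    ∃ ls : ℕ → Measure (E d₁ × E d₂),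
      (∀ n, (ls n).map Prod.fst = σs n ∧ (ls n).map Prod.snd = ρs n) ∧
      WkTendsto ls l ∧
      limsup (fun n => ((∫ p, gs n p ∂ls n : ℝ) : EReal) +
          (ηs n : EReal) * (KL (ls n) (prodM (σs n) (ρs n)) : EReal)) atTop ≤
        ((∫ p, g p ∂l : ℝ) : EReal) + (η : EReal) * (KL l (prodM σ ρ) : EReal) := by
  have hσsZ' : ∀ n, ∀ᵐ x ∂σs n, x ∈ Z := fun n => hσZ n
  have hρsY' : ∀ n, ∀ᵐ y ∂ρs n, y ∈ Y := fun n => hρY n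
  have hpm : ∀ {α : Measure (E d₁)} {β : Measure (E d₂)}, prodM α β = α.prod β := by
    intro α β
    rw [Measure.prod_def]
    rfl
  set L : ℝ≥0∞ := KL l (prodM σ ρ) with hLdef
  set e : ℕ → ℝ := fun k => 1 / ((k : ℝ) + 1) with he
  have he0 : ∀ k, 0 < e k := fun k => Nat.one_div_pos_of_nat
  have he1 : ∀ k, e k ≤ 1 := fun k => by
    rw [he, div_le_one (by positivity)]
    linarith [(Nat.cast_nonneg k : (0 : ℝ) ≤ k)]
  have helim : Tendsto e atTop (nhds 0) := tendsto_one_div_add_atTop_nhds_zero_nat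
  have happrox : ∀ k, ∀ᶠ n in atTop, ∃ μ : Measure (E d₁ × E d₂),
      (μ.map Prod.fst = σs n ∧ μ.map Prod.snd = ρs n) ∧ WkClose (Z ×ˢ Y) (e k) μ l ∧
        (ηs n : EReal) * (KL μ (prodM (σs n) (ρs n)) : EReal) ≤
          (η : EReal) * (L : EReal) + ((e k * (η + 1) : ℝ) : EReal) := by
    intro k
    obtain ⟨C, hC0, hCL, hC⟩ := exists_eventually_coupling_wkClose hZ hY hσsZ' hσZ' hσ hρsY' hρY'
      hρ l hl1 hl2 (he0 k) (he1 k)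
    rw [← hpm] at hCL
    filter_upwards [hC, eventually_mul_coe_ennreal_le hηs hη hηlim hC0 (he0 k) hCL] with n hn hn'
    obtain ⟨μ, h1, h2, h3, h4⟩ := hn
    exact ⟨μ, ⟨h1, h2⟩, h3, hn' _ (hpm ▸ h4)⟩
  obtain ⟨k, hk, hP⟩ := exists_tendsto_atTop_eventually_diagonal happrox
  have hex : ∀ n, ∃ μ : Measure (E d₁ × E d₂),
      (μ.map Prod.fst = σs n ∧ μ.map Prod.snd = ρs n) ∧ ((∃ μ : Measure (E d₁ × E d₂),
        (μ.map Prod.fst = σs n ∧ μ.map Prod.snd = ρs n) ∧ WkClose (Z ×ˢ Y) (e (k n)) μ l ∧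
          (ηs n : EReal) * (KL μ (prodM (σs n) (ρs n)) : EReal) ≤
            (η : EReal) * (L : EReal) + ((e (k n) * (η + 1) : ℝ) : EReal)) →
        WkClose (Z ×ˢ Y) (e (k n)) μ l ∧
          (ηs n : EReal) * (KL μ (prodM (σs n) (ρs n)) : EReal) ≤
            (η : EReal) * (L : EReal) + ((e (k n) * (η + 1) : ℝ) : EReal)) := by
    intro n
    by_cases h : ∃ μ : Measure (E d₁ × E d₂),
        (μ.map Prod.fst = σs n ∧ μ.map Prod.snd = ρs n) ∧ WkClose (Z ×ˢ Y) (e (k n)) μ l ∧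
          (ηs n : EReal) * (KL μ (prodM (σs n) (ρs n)) : EReal) ≤
            (η : EReal) * (L : EReal) + ((e (k n) * (η + 1) : ℝ) : EReal)
    · obtain ⟨μ, h1, h2⟩ := h
      exact ⟨μ, h1, fun _ => h2⟩
    · exact ⟨(σs n).prod (ρs n), by simp, fun h' => absurd h' h⟩
  choose ls hmarg hls using hex
  have hek : Tendsto (fun n => e (k n)) atTop (nhds 0) := helim.comp hk
  have hwk : WkTendsto ls l := wkTendsto_of_wkClose (hZ.prod hY) hek
    (hP.mono fun n hn => (hls n hn).1)
  refine ⟨ls, hmarg, hwk, ?_⟩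
  have hprob : ∀ n, IsProbabilityMeasure (ls n) := fun n => ⟨by
    rw [← preimage_univ (f := Prod.fst), ← Measure.map_apply measurable_fst .univ, (hmarg n).1,
      measure_univ]⟩
  have hint := tendsto_integral_of_tendstoUniformly_of_wkTendsto (hZ.prod hY)
    (fun n => ae_mem_prod_of_map_fst_of_map_snd (hmarg n).1 (hmarg n).2 (hσsZ' n) (hρsY' n))
    hwk hgc hg hgu
  have hV0 : 0 ≤ (η : EReal) * (L : EReal) :=
    mul_nonneg (EReal.coe_nonneg.2 hη) (EReal.coe_ennreal_nonneg L)
  have hle : ∀ᶠ n in atTop, ((∫ p, gs n p ∂ls n : ℝ) : EReal) +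
      (ηs n : EReal) * (KL (ls n) (prodM (σs n) (ρs n)) : EReal) ≤
        ((∫ p, gs n p ∂ls n : ℝ) : EReal) +
          ((η : EReal) * (L : EReal) + ((e (k n) * (η + 1) : ℝ) : EReal)) :=
    hP.mono fun n hn => add_le_add_right (hls n hn).2 _
  generalize (η : EReal) * (L : EReal) = V at hV0 hle
  induction V with
  | bot => simp at hV0
  | top => simp
  | coe v =>
    refine (limsup_le_limsup hle).trans (le_of_eq (Tendsto.limsup_eq ?_))
    have hreal : Tendsto (fun n => ∫ p, gs n p ∂ls n + (v + e (k n) * (η + 1))) atTop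
        (nhds (∫ p, g p ∂l + v)) := by
      simpa using hint.add ((hek.mul_const (η + 1)).const_add v)
    simpa only [EReal.coe_add, Function.comp_def] using (continuous_coe_real_ereal.tendsto _).comp hreal
end
end

section
/- Let X = [0,1]^d, let Y ⊂ ℝ^d be compact, and let μ be a Borel probability measure on X. Then for all π, π' ∈ Π(μ): 𝒲(π, π') = inf { ∫_{(X×Y)²} ‖(x,y) − (x',y')‖ dγ((x,y),(x',y')) : γ a Borel probability measure on (X×Y)×(X×Y) with first marginal π and second marginal π' such that x = x' for γ-almost every ((x,y),(x',y')) }, where ‖·‖ is the Euclidean norm on ℝ^{2d}. -/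
open MeasureTheory Set Filter
open scoped ENNReal Classical

noncomputable section

/-- The vertical transport metric `𝒲(π, π') = ∫ W_Y(π_x, π'_x) dμ(x)`. -/
noncomputable def VW {α Ω : Type*} [MeasurableSpace α] [MeasurableSpace Ω] [PseudoEMetricSpace Ω]
    [StandardBorelSpace Ω] [Nonempty Ω]
    (μ : Measure α) (π π' : Measure (α × Ω)) : ℝ≥0∞ :=
  ∫⁻ x, W1 (disint π x) (disint π' x) ∂μ

/-- Euclidean distance on `ℝ^d × ℝ^d = ℝ^{2d}`. -/
noncomputable def edistE2 {d₁ d₂ : ℕ} (p q : E d₁ × E d₂) : ℝ≥0∞ :=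
  ENNReal.ofReal (Real.sqrt (dist p.1 q.1 ^ 2 + dist p.2 q.2 ^ 2))

/-- The cube `X = [0,1]^d`. -/
def Xcube (d : ℕ) : Set (E d) := {x | ∀ i, x i ∈ Icc (0:ℝ) 1}

section FiniteCoupling

variable {ι : Type*} [Fintype ι]

/-- Completes a sub-coupling `Q` of the weights `a` and `b` by the normalized product of the
residual weights. -/
def completeCoupling (Q : ι → ι → ℝ≥0∞) (a b : ι → ℝ≥0∞) (i j : ι) : ℝ≥0∞ :=
  Q i j + (a i - ∑ l, Q i l) * (b j - ∑ k, Q k j) / ∑ k, (a k - ∑ l, Q k l)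

theorem sum_residual_eq {Q : ι → ι → ℝ≥0∞} {a b : ι → ℝ≥0∞}
    (hrow : ∀ i, ∑ j, Q i j ≤ a i) (hcol : ∀ j, ∑ i, Q i j ≤ b j)
    (hab : ∑ i, a i = ∑ j, b j) (ha : ∑ i, a i ≠ ∞) :
    ∑ i, (a i - ∑ j, Q i j) = ∑ j, (b j - ∑ i, Q i j) := by
  have h1 : ∑ i, (a i - ∑ j, Q i j) + ∑ i, ∑ j, Q i j = ∑ i, a i := by
    rw [← Finset.sum_add_distrib]
    exact Finset.sum_congr rfl fun i _ => tsub_add_cancel_of_le (hrow i)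
  have h2 : ∑ j, (b j - ∑ i, Q i j) + ∑ i, ∑ j, Q i j = ∑ i, a i := by
    rw [Finset.sum_comm, ← Finset.sum_add_distrib, hab]
    exact Finset.sum_congr rfl fun i _ => tsub_add_cancel_of_le (hcol i)
  have h3 : ∑ i, ∑ j, Q i j ≠ ∞ :=
    ne_top_of_le_ne_top ha (Finset.sum_le_sum fun i _ => hrow i)
  exact (ENNReal.add_left_inj h3).1 (h1.trans h2.symm)

theorem sum_completeCoupling_right {Q : ι → ι → ℝ≥0∞} {a b : ι → ℝ≥0∞}
    (hrow : ∀ i, ∑ j, Q i j ≤ a i) (hcol : ∀ j, ∑ i, Q i j ≤ b j)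
    (hab : ∑ i, a i = ∑ j, b j) (ha : ∑ i, a i ≠ ∞) (i : ι) :
    ∑ j, completeCoupling Q a b i j = a i := by
  have hres := sum_residual_eq hrow hcol hab ha
  have hfin : ∑ k, (a k - ∑ l, Q k l) ≠ ∞ :=
    ne_top_of_le_ne_top ha (Finset.sum_le_sum fun i _ => tsub_le_self)
  simp only [completeCoupling, Finset.sum_add_distrib, mul_div_assoc]
  rw [← Finset.mul_sum]
  simp only [div_eq_mul_inv]
  rw [← Finset.sum_mul, ← hres]
  rcases eq_or_ne (∑ k, (a k - ∑ l, Q k l)) 0 with h0 | h0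
  · rw [(Finset.sum_eq_zero_iff.1 h0) i (Finset.mem_univ i), zero_mul, add_zero]
    exact le_antisymm (hrow i)
      (tsub_eq_zero_iff_le.1 ((Finset.sum_eq_zero_iff.1 h0) i (Finset.mem_univ i)))
  · rw [ENNReal.mul_inv_cancel h0 hfin, mul_one, add_tsub_cancel_of_le (hrow i)]

theorem sum_completeCoupling_left {Q : ι → ι → ℝ≥0∞} {a b : ι → ℝ≥0∞}
    (hrow : ∀ i, ∑ j, Q i j ≤ a i) (hcol : ∀ j, ∑ i, Q i j ≤ b j)
    (hab : ∑ i, a i = ∑ j, b j) (ha : ∑ i, a i ≠ ∞) (j : ι) :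
    ∑ i, completeCoupling Q a b i j = b j := by
  rw [← sum_completeCoupling_right (Q := fun j i => Q i j) (a := b) (b := a) hcol hrow hab.symm
    (hab ▸ ha) j]
  refine Finset.sum_congr rfl fun i _ => ?_
  rw [completeCoupling, completeCoupling, sum_residual_eq hrow hcol hab ha, mul_comm (a i - _)]

theorem completeCoupling_le {Q : ι → ι → ℝ≥0∞} {a b : ι → ℝ≥0∞}
    (hrow : ∀ i, ∑ j, Q i j ≤ a i) (hcol : ∀ j, ∑ i, Q i j ≤ b j)
    (hab : ∑ i, a i = ∑ j, b j) (ha : ∑ i, a i ≠ ∞) (i j : ι) :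
    completeCoupling Q a b i j ≤ Q i j + (a i - ∑ l, Q i l) := by
  rw [completeCoupling, sum_residual_eq hrow hcol hab ha, mul_div_assoc]
  gcongr
  refine mul_le_of_le_one_right' (ENNReal.div_le_of_le_mul ?_)
  rw [one_mul]
  exact Finset.single_le_sum (f := fun j => b j - ∑ i, Q i j) (fun _ _ => zero_le)
    (Finset.mem_univ j)

theorem ENNReal.exists_nat_div_le {m : ℝ≥0∞} (hm : m ≠ ∞) {K : ℕ} (hK : K ≠ 0) :
    ∃ n : ℕ, (n : ℝ≥0∞) / K ≤ m ∧ m ≤ n / K + 1 / K := by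
  lift m to NNReal using hm
  have hK0 : (0 : NNReal) < K := by exact_mod_cast Nat.pos_of_ne_zero hK
  refine ⟨⌊m * K⌋₊, ?_, ?_⟩
  · have : ((⌊m * K⌋₊ : NNReal) / K : NNReal) ≤ m := by
      rw [div_le_iff₀ hK0]; exact Nat.floor_le zero_le
    exact_mod_cast (ENNReal.coe_le_coe.2 this).trans_eq' (by
      rw [ENNReal.coe_div hK0.ne']; simp)
  · have : m ≤ ((⌊m * K⌋₊ : NNReal) / K + 1 / K : NNReal) := by
      rw [← add_div, le_div_iff₀ hK0]; exact (Nat.lt_floor_add_one _).le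
    refine (ENNReal.coe_le_coe.2 this).trans_eq ?_
    rw [ENNReal.coe_add, ENNReal.coe_div hK0.ne', ENNReal.coe_div hK0.ne']; simp

/-- A finite coupling can be replaced, up to a small cost, by the completion of a sub-coupling
with entries in `ℕ / K`. -/
theorem exists_nat_completeCoupling_cost_le (m c : ι → ι → ℝ≥0∞)
    (hm : ∑ i, ∑ j, m i j ≠ ∞) {K : ℕ} (hK : K ≠ 0) :
    ∃ q : ι → ι → ℕ, (∀ i, ∑ j, (q i j : ℝ≥0∞) / K ≤ ∑ j, m i j) ∧
      (∀ j, ∑ i, (q i j : ℝ≥0∞) / K ≤ ∑ i, m i j) ∧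
      ∑ i, ∑ j, completeCoupling (fun i j => (q i j : ℝ≥0∞) / K) (fun i => ∑ j, m i j)
        (fun j => ∑ i, m i j) i j * c i j ≤
      ∑ i, ∑ j, m i j * c i j + Fintype.card ι / K * ∑ i, ∑ j, c i j := by
  have hmij : ∀ i j, m i j ≠ ∞ := fun i j =>
    ne_top_of_le_ne_top hm <|
      (Finset.single_le_sum (f := fun j => m i j) (fun _ _ => zero_le) (Finset.mem_univ j)).trans
      (Finset.single_le_sum (f := fun i => ∑ j, m i j) (fun _ _ => zero_le) (Finset.mem_univ i))
  choose q hq1 hq2 using fun i j => ENNReal.exists_nat_div_le (hmij i j) hK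
  have hrow : ∀ i, ∑ j, (q i j : ℝ≥0∞) / K ≤ ∑ j, m i j :=
    fun i => Finset.sum_le_sum fun j _ => hq1 i j
  have hcol : ∀ j, ∑ i, (q i j : ℝ≥0∞) / K ≤ ∑ i, m i j :=
    fun j => Finset.sum_le_sum fun i _ => hq1 i j
  refine ⟨q, hrow, hcol, ?_⟩
  rw [Finset.mul_sum, ← Finset.sum_add_distrib]
  refine Finset.sum_le_sum fun i _ => ?_
  rw [Finset.mul_sum, ← Finset.sum_add_distrib]
  refine Finset.sum_le_sum fun j _ => ?_
  rw [← add_mul]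
  gcongr
  refine (completeCoupling_le (Q := fun i j => (q i j : ℝ≥0∞) / K) hrow hcol
    Finset.sum_comm hm i j).trans ?_
  gcongr
  · exact hq1 i j
  · rw [tsub_le_iff_left]
    refine (Finset.sum_le_sum fun j _ => hq2 i j).trans_eq ?_
    rw [Finset.sum_add_distrib, Finset.sum_const, Finset.card_univ, nsmul_eq_mul, mul_one_div]

end FiniteCoupling

theorem exists_measurable_index_le_iInf_add {X : Type*} [MeasurableSpace X]
    {c : ℕ → X → ℝ≥0∞} (hc : ∀ n, Measurable (c n)) (hfin : ∀ x, ⨅ n, c n x ≠ ∞)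
    {ε : ℝ≥0∞} (hε : ε ≠ 0) :
    ∃ N : X → ℕ, Measurable N ∧ ∀ x, c (N x) x ≤ (⨅ n, c n x) + ε := by
  have hex : ∀ x, ∃ n, c n x ≤ (⨅ n, c n x) + ε := fun x => by
    obtain ⟨n, hn⟩ := iInf_lt_iff.1 (ENNReal.lt_add_right (hfin x) hε)
    exact ⟨n, hn.le⟩
  exact ⟨fun x => Nat.find (hex x), measurable_find hex fun n =>
    measurableSet_le (hc n) ((Measurable.iInf hc).add_const ε), fun x => Nat.find_spec (hex x)⟩

theorem exists_measurable_coupling {ι X : Type*} [Fintype ι] [MeasurableSpace X]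
    {a b : X → ι → ℝ≥0∞} (ha : ∀ i, Measurable fun x => a x i)
    (hb : ∀ j, Measurable fun x => b x j) (ha1 : ∀ x, ∑ i, a x i = 1) (hb1 : ∀ x, ∑ j, b x j = 1)
    {c : ι → ι → ℝ≥0∞} (hc : ∀ i j, c i j ≠ ∞) {ε : ℝ≥0∞} (hε : ε ≠ 0)
    (hε' : ε ≠ ∞) :
    ∃ M : X → ι → ι → ℝ≥0∞, (∀ i j, Measurable fun x => M x i j) ∧
      (∀ x i, ∑ j, M x i j = a x i) ∧ (∀ x j, ∑ i, M x i j = b x j) ∧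
      ∀ x (m : ι → ι → ℝ≥0∞), (∀ i, ∑ j, m i j = a x i) → (∀ j, ∑ i, m i j = b x j) →
        ∑ i, ∑ j, M x i j * c i j ≤ ∑ i, ∑ j, m i j * c i j + ε := by
  have hε2 : ε / 2 ≠ 0 := (ENNReal.half_pos hε).ne'
  have hD : (Fintype.card ι : ℝ≥0∞) * ∑ i, ∑ j, c i j ≠ ∞ :=
    ENNReal.mul_ne_top (ENNReal.natCast_ne_top _)
      (ENNReal.sum_ne_top.2 fun i _ => ENNReal.sum_ne_top.2 fun j _ => hc i j)
  obtain ⟨K, hK0, hK⟩ := ENNReal.exists_nat_pos_mul_gt hε2 hD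
  have hKε : (Fintype.card ι : ℝ≥0∞) / K * ∑ i, ∑ j, c i j ≤ ε / 2 := by
    rw [← ENNReal.mul_div_right_comm]
    exact ENNReal.div_le_of_le_mul (by rw [mul_comm (ε / 2)]; exact hK.le)
  obtain ⟨e, he⟩ := exists_surjective_nat (ι → ι → ℕ)
  let Q : ℕ → ι → ι → ℝ≥0∞ := fun n i j => (e n i j : ℝ≥0∞) / K
  let S : ℕ → Set X := fun n =>
    {x | (∀ i, ∑ j, Q n i j ≤ a x i) ∧ ∀ j, ∑ i, Q n i j ≤ b x j}
  have hS : ∀ n, MeasurableSet (S n) := fun n => by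
    have : S n = (⋂ i, {x | ∑ j, Q n i j ≤ a x i}) ∩ ⋂ j, {x | ∑ i, Q n i j ≤ b x j} := by
      ext x; simp [S]
    rw [this]
    exact (MeasurableSet.iInter fun i => measurableSet_le measurable_const (ha i)).inter
      (MeasurableSet.iInter fun j => measurableSet_le measurable_const (hb j))
  have hM : ∀ n i j, Measurable fun x => completeCoupling (Q n) (a x) (b x) i j := fun n i j => by
    unfold completeCoupling
    fun_prop
  let C : ℕ → X → ℝ≥0∞ := fun n x =>
    if x ∈ S n then ∑ i, ∑ j, completeCoupling (Q n) (a x) (b x) i j * c i j else ∞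
  have hC : ∀ n, Measurable (C n) := fun n => by
    refine Measurable.ite (hS n) ?_ measurable_const
    exact Finset.measurable_sum _ fun i _ => Finset.measurable_sum _ fun j _ =>
      (hM n i j).mul_const _
  have hrow := fun x n (h : x ∈ S n) =>
    sum_completeCoupling_right h.1 h.2 ((ha1 x).trans (hb1 x).symm) (by simp [ha1 x])
  have hcol := fun x n (h : x ∈ S n) =>
    sum_completeCoupling_left h.1 h.2 ((ha1 x).trans (hb1 x).symm) (by simp [ha1 x])
  have hle : ∀ x (m : ι → ι → ℝ≥0∞), (∀ i, ∑ j, m i j = a x i) → (∀ j, ∑ i, m i j = b x j) →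
      ⨅ n, C n x ≤ ∑ i, ∑ j, m i j * c i j + ε / 2 := by
    intro x m hma hmb
    obtain ⟨q, hq1, hq2, hq3⟩ := exists_nat_completeCoupling_cost_le m c
      (by simp [hma, ha1 x]) hK0.ne'
    obtain ⟨n, rfl⟩ := he q
    simp only [hma, hmb] at hq1 hq2 hq3
    refine (iInf_le _ n).trans ?_
    have hx : x ∈ S n := ⟨hq1, hq2⟩
    simp only [C, if_pos hx]
    exact hq3.trans (by gcongr)
  have hfin : ∀ x, ⨅ n, C n x ≠ ∞ := fun x => by
    refine ne_top_of_le_ne_top ?_ (hle x (fun i j => a x i * b x j) (fun i => ?_) fun j => ?_)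
    · have hx : ∀ i, a x i ≠ ∞ := fun i =>
        ENNReal.sum_ne_top.1 (by simp [ha1 x] : ∑ i, a x i ≠ ∞) i (Finset.mem_univ i)
      have hx' : ∀ j, b x j ≠ ∞ := fun j =>
        ENNReal.sum_ne_top.1 (by simp [hb1 x] : ∑ j, b x j ≠ ∞) j (Finset.mem_univ j)
      exact ENNReal.add_ne_top.2 ⟨ENNReal.sum_ne_top.2 fun i _ => ENNReal.sum_ne_top.2 fun j _ =>
        ENNReal.mul_ne_top (ENNReal.mul_ne_top (hx i) (hx' j)) (hc i j),
        ne_top_of_le_ne_top hε' ENNReal.half_le_self⟩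
    · rw [← Finset.mul_sum, hb1, mul_one]
    · rw [← Finset.sum_mul, ha1, one_mul]
  obtain ⟨N, hN, hNle⟩ := exists_measurable_index_le_iInf_add hC hfin hε2
  have hNS : ∀ x, x ∈ S (N x) := fun x => by
    by_contra h
    refine ENNReal.add_ne_top.2 ⟨hfin x, ne_top_of_le_ne_top hε' ENNReal.half_le_self⟩
      (top_le_iff.1 ((hNle x).trans' ?_))
    simp only [C, if_neg h, le_refl]
  refine ⟨fun x => completeCoupling (Q (N x)) (a x) (b x), fun i j => ?_,
    fun x => hrow x _ (hNS x), fun x => hcol x _ (hNS x), fun x m hma hmb => ?_⟩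
  · have h : Measurable fun p : ℕ × X => completeCoupling (Q p.1) (a p.2) (b p.2) i j :=
      measurable_from_prod_countable_right fun n => hM n i j
    have h' : Measurable fun x => (N x, x) := hN.prodMk measurable_id
    have h'' := h.comp h'
    simpa only [Function.comp_def] using h''
  · have h := hNle x
    simp only [C, if_pos (hNS x)] at h
    calc _ ≤ (⨅ n, C n x) + ε / 2 := h
      _ ≤ ∑ i, ∑ j, m i j * c i j + ε / 2 + ε / 2 := by gcongr; exact hle x m hma hmb
      _ = _ := by rw [add_assoc, ENNReal.add_halves]

section Density

variable {ι Ω : Type*} [Fintype ι] [MeasurableSpace Ω]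

theorem ae_measure_fiber_ne_zero {T : Ω → ι} (ν : Measure Ω) :
    ∀ᵐ y ∂ν, ν (T ⁻¹' {T y}) ≠ 0 := by
  rw [ae_iff]
  refine measure_mono_null (t := ⋃ i ∈ {i | ν (T ⁻¹' {i}) = 0}, T ⁻¹' {i}) (fun y hy => ?_) ?_
  · simpa using hy
  · exact (measure_biUnion_null_iff (Set.to_countable _)).2 fun i hi => hi

variable {T : Ω → ι} {ν ν' : Measure Ω}
  {m : ι → ι → ℝ≥0∞}

/-- The density, with respect to a product measure `ν ⊗ ν'`, of the lift of a finite coupling `m`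
of the images of `ν` and `ν'` under `T`. -/
def liftDensity (T : Ω → ι) (ν ν' : Measure Ω) (m : ι → ι → ℝ≥0∞) (i j : ι) : ℝ≥0∞ :=
  m i j / (ν (T ⁻¹' {i}) * ν' (T ⁻¹' {j}))

theorem liftDensity_mul_mul [IsFiniteMeasure ν] [IsFiniteMeasure ν']
    (hrow : ∀ i, ∑ j, m i j = ν (T ⁻¹' {i}))
    (hcol : ∀ j, ∑ i, m i j = ν' (T ⁻¹' {j})) (i j : ι) :
    liftDensity T ν ν' m i j * ν' (T ⁻¹' {j}) * ν (T ⁻¹' {i}) = m i j := by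
  rw [liftDensity, mul_assoc, mul_comm (ν' _)]
  refine ENNReal.div_mul_cancel' (fun h => ?_) (fun h => ?_)
  · rcases mul_eq_zero.1 h with h | h
    · rw [← hrow] at h
      exact Finset.sum_eq_zero_iff.1 h j (Finset.mem_univ j)
    · rw [← hcol] at h
      exact Finset.sum_eq_zero_iff.1 h i (Finset.mem_univ i)
  · exact absurd h (ENNReal.mul_ne_top (measure_ne_top _ _) (measure_ne_top _ _))

variable [MeasurableSpace ι] [MeasurableSingletonClass ι]

theorem lintegral_comp_fintype {T : Ω → ι} (hT : Measurable T) (ν : Measure Ω) (f : ι → ℝ≥0∞) :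
    ∫⁻ y, f (T y) ∂ν = ∑ i, f i * ν (T ⁻¹' {i}) := by
  rw [← lintegral_map (measurable_of_countable f) hT, lintegral_fintype]
  exact Finset.sum_congr rfl fun i _ => by rw [Measure.map_apply hT (measurableSet_singleton i)]

theorem sum_measure_fiber {T : Ω → ι} (hT : Measurable T) (ν : Measure Ω) :
    ∑ i, ν (T ⁻¹' {i}) = ν univ := by
  simpa using (lintegral_comp_fintype hT ν fun _ => 1).symm

theorem lintegral_liftDensity_right [IsFiniteMeasure ν] [IsFiniteMeasure ν']
    (hT : Measurable T)
    (hrow : ∀ i, ∑ j, m i j = ν (T ⁻¹' {i}))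
    (hcol : ∀ j, ∑ i, m i j = ν' (T ⁻¹' {j})) :
    ∀ᵐ y ∂ν, ∫⁻ y', liftDensity T ν ν' m (T y) (T y') ∂ν' = 1 := by
  filter_upwards [ae_measure_fiber_ne_zero (T := T) ν] with y hy
  rw [lintegral_comp_fintype hT ν']
  refine (ENNReal.mul_left_inj hy (measure_ne_top _ _)).1 ?_
  rw [Finset.sum_mul, one_mul]
  refine Eq.trans (Finset.sum_congr rfl fun j _ => ?_) (hrow (T y))
  exact liftDensity_mul_mul hrow hcol _ j

theorem lintegral_liftDensity_left [IsFiniteMeasure ν] [IsFiniteMeasure ν']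
    (hT : Measurable T)
    (hrow : ∀ i, ∑ j, m i j = ν (T ⁻¹' {i}))
    (hcol : ∀ j, ∑ i, m i j = ν' (T ⁻¹' {j})) :
    ∀ᵐ y' ∂ν', ∫⁻ y, liftDensity T ν ν' m (T y) (T y') ∂ν = 1 := by
  filter_upwards [lintegral_liftDensity_right (m := fun j i => m i j) hT hcol hrow] with y' hy'
  rw [← hy']
  simp only [liftDensity, mul_comm]

theorem lintegral_lintegral_liftDensity_mul [IsFiniteMeasure ν] [IsFiniteMeasure ν']
    (hT : Measurable T)
    (hrow : ∀ i, ∑ j, m i j = ν (T ⁻¹' {i}))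
    (hcol : ∀ j, ∑ i, m i j = ν' (T ⁻¹' {j})) (F : ι → ι → ℝ≥0∞) :
    ∫⁻ y, ∫⁻ y', liftDensity T ν ν' m (T y) (T y') * F (T y) (T y') ∂ν' ∂ν =
      ∑ i, ∑ j, m i j * F i j := by
  simp_rw [fun y => lintegral_comp_fintype hT ν'
    (fun j => liftDensity T ν ν' m (T y) j * F (T y) j)]
  rw [lintegral_comp_fintype hT ν
    (fun i => ∑ j, liftDensity T ν ν' m i j * F i j * ν' (T ⁻¹' {j}))]
  refine Finset.sum_congr rfl fun i _ => ?_
  rw [Finset.sum_mul]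
  refine Finset.sum_congr rfl fun j _ => ?_
  rw [← liftDensity_mul_mul hrow hcol i j]
  ring

/-- The masses that a coupling gives to the products of fibers of `T` form a finite coupling. -/
theorem sum_coupling_fiber (hT : Measurable T) {γ : Measure (Ω × Ω)}
    (h1 : γ.map Prod.fst = ν) (h2 : γ.map Prod.snd = ν') :
    (∀ i, ∑ j, γ (Prod.map T T ⁻¹' {(i, j)}) = ν (T ⁻¹' {i})) ∧
      ∀ j, ∑ i, γ (Prod.map T T ⁻¹' {(i, j)}) = ν' (T ⁻¹' {j}) := by
  refine ⟨fun i => ?_, fun j => ?_⟩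
  · have h := sum_measure_fiber (hT.comp measurable_snd)
      (γ.restrict ((T ∘ Prod.fst) ⁻¹' {i}))
    rw [Measure.restrict_apply_univ] at h
    rw [← h1, Measure.map_apply measurable_fst (hT (measurableSet_singleton i)),
      ← preimage_comp, ← h]
    refine Finset.sum_congr rfl fun j _ => ?_
    rw [Measure.restrict_apply (hT.comp measurable_snd (measurableSet_singleton j))]
    congr 1
    ext p
    simp [Prod.ext_iff, and_comm]
  · have h := sum_measure_fiber (hT.comp measurable_fst)
      (γ.restrict ((T ∘ Prod.snd) ⁻¹' {j}))
    rw [Measure.restrict_apply_univ] at h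
    rw [← h2, Measure.map_apply measurable_snd (hT (measurableSet_singleton j)),
      ← preimage_comp, ← h]
    refine Finset.sum_congr rfl fun i _ => ?_
    rw [Measure.restrict_apply (hT.comp measurable_fst (measurableSet_singleton i))]
    congr 1
    ext p
    simp [Prod.ext_iff]

end Density

theorem IsCompact.exists_measurable_fin_quantization {Ω : Type*} [PseudoEMetricSpace Ω]
    [TopologicalSpace.SeparableSpace Ω] [Nonempty Ω] [MeasurableSpace Ω] [OpensMeasurableSpace Ω]
    {Y : Set Ω} (hY : IsCompact Y) {δ : ℝ≥0∞} (hδ : δ ≠ 0) :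
    ∃ (n : ℕ) (t : Fin n → Ω) (T : Ω → Fin n), Measurable T ∧
      ∀ y ∈ Y, edist (t (T y)) y ≤ δ := by
  let e := TopologicalSpace.denseSeq Ω
  obtain ⟨s, hs⟩ := hY.elim_finite_subcover (fun n => Metric.eball (e n) δ)
    (fun n => Metric.isOpen_eball) fun y _ => by
      obtain ⟨_, ⟨n, rfl⟩, hn⟩ := EMetric.mem_closure_iff.1
        ((TopologicalSpace.denseRange_denseSeq Ω) y) δ (pos_iff_ne_zero.2 hδ)
      exact mem_iUnion.2 ⟨n, hn⟩
  let N := s.sup id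
  refine ⟨N + 1, fun k => e k, fun y => ⟨SimpleFunc.nearestPtInd e N y,
    Nat.lt_succ_of_le (SimpleFunc.nearestPtInd_le e N y)⟩, ?_, fun y hy => ?_⟩
  · refine measurable_to_countable' fun k => ?_
    convert (SimpleFunc.nearestPtInd e N).measurableSet_preimage {(k : ℕ)} using 1
    ext y
    simp [Fin.ext_iff]
  · obtain ⟨k, hk, hyk⟩ := mem_iUnion₂.1 (hs hy)
    refine (SimpleFunc.edist_nearestPt_le e y (k := k) (N := N) (Finset.le_sup (f := id) hk)).trans ?_
    rw [edist_comm]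
    exact (Metric.mem_eball.1 hyk).le

open ProbabilityTheory in
/-- Markov kernels carried by a compact set admit vertical couplings whose cost is arbitrarily
close to the integral of the fiberwise Wasserstein distances. -/
theorem exists_vertical_coupling {X Ω : Type*} [MeasurableSpace X] [PseudoMetricSpace Ω]
    [SecondCountableTopology Ω] [Nonempty Ω] [MeasurableSpace Ω] [OpensMeasurableSpace Ω]
    {μ : Measure X} [SFinite μ] {κ κ' : Kernel X Ω} [IsMarkovKernel κ] [IsMarkovKernel κ']
    (hμ : μ univ = 1) {Y : Set Ω} (hY : IsCompact Y)
    (hκ : ∀ᵐ x ∂μ, ∀ᵐ y ∂κ x, y ∈ Y)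
    (hκ' : ∀ᵐ x ∂μ, ∀ᵐ y ∂κ' x, y ∈ Y) {ε : ℝ≥0∞} (hε : ε ≠ 0) (hε' : ε ≠ ∞) :
    ∃ P : Measure (X × Ω × Ω), P.map (fun p => (p.1, p.2.1)) = μ ⊗ₘ κ ∧
      P.map (fun p => (p.1, p.2.2)) = μ ⊗ₘ κ' ∧
      ∫⁻ p, edist p.2.1 p.2.2 ∂P ≤ ∫⁻ x, W1 (κ x) (κ' x) ∂μ + 5 * ε := by
  obtain ⟨n, t, T, hT, htT⟩ := hY.exists_measurable_fin_quantization hε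
  have hTi : ∀ i, MeasurableSet (T ⁻¹' {i}) := fun i => hT (measurableSet_singleton i)
  let c : Fin n → Fin n → ℝ≥0∞ := fun i j => edist (t i) (t j)
  have hκi : ∀ i, Measurable fun x => κ x (T ⁻¹' {i}) := fun i => κ.measurable_coe (hTi i)
  have hκ'i : ∀ i, Measurable fun x => κ' x (T ⁻¹' {i}) := fun i => κ'.measurable_coe (hTi i)
  obtain ⟨M, hM, hrow, hcol, hcost⟩ := exists_measurable_coupling
    (a := fun x i => κ x (T ⁻¹' {i})) (b := fun x j => κ' x (T ⁻¹' {j})) hκi hκ'i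
    (fun x => by rw [sum_measure_fiber hT, measure_univ])
    (fun x => by rw [sum_measure_fiber hT, measure_univ])
    (c := c) (fun i j => edist_ne_top _ _) hε hε'
  let H : X × Ω × Ω → ℝ≥0∞ := fun p =>
    liftDensity T (κ p.1) (κ' p.1) (M p.1) (T p.2.1) (T p.2.2)
  have hH : Measurable H := by
    have h : Measurable fun q : X × Fin n × Fin n =>
        liftDensity T (κ q.1) (κ' q.1) (M q.1) q.2.1 q.2.2 :=
      measurable_from_prod_countable_left fun q => by
        exact (hM q.1 q.2).div ((hκi q.1).mul (hκ'i q.2))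
    exact h.comp (measurable_fst.prodMk
      ((hT.comp (measurable_fst.comp measurable_snd)).prodMk
        (hT.comp (measurable_snd.comp measurable_snd))))
  have hint : ∀ f : X × Ω × Ω → ℝ≥0∞, Measurable f →
      ∫⁻ p, f p ∂((μ ⊗ₘ (κ ×ₖ κ')).withDensity H) =
        ∫⁻ x, ∫⁻ y, ∫⁻ y', H (x, y, y') * f (x, y, y') ∂κ' x ∂κ x ∂μ := fun f hf => by
    rw [lintegral_withDensity_eq_lintegral_mul _ hH hf, Measure.lintegral_compProd (hH.mul hf)]
    refine lintegral_congr fun x => ?_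
    rw [Kernel.prod_apply]
    exact lintegral_prod (fun q => H (x, q) * f (x, q)) (by fun_prop)
  refine ⟨(μ ⊗ₘ (κ ×ₖ κ')).withDensity H, ?_, ?_, ?_⟩
  · refine Measure.ext_of_lintegral _ fun f hf => ?_
    rw [lintegral_map hf (by fun_prop), hint _ (by fun_prop), Measure.lintegral_compProd hf]
    refine lintegral_congr fun x => lintegral_congr_ae ?_
    filter_upwards [lintegral_liftDensity_right hT (hrow x) (hcol x)] with y hy
    rw [lintegral_mul_const _ (by fun_prop), hy, one_mul]
  · refine Measure.ext_of_lintegral _ fun f hf => ?_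
    rw [lintegral_map hf (by fun_prop), hint _ (by fun_prop), Measure.lintegral_compProd hf]
    refine lintegral_congr fun x => ?_
    rw [lintegral_lintegral_swap (by fun_prop)]
    refine lintegral_congr_ae ?_
    filter_upwards [lintegral_liftDensity_left hT (hrow x) (hcol x)] with y' hy'
    rw [lintegral_mul_const _ (by fun_prop), hy', one_mul]
  · rw [hint _ (by fun_prop)]
    have hbound : ∀ᵐ x ∂μ, ∫⁻ y, ∫⁻ y', H (x, y, y') * edist y y' ∂κ' x ∂κ x ≤
        W1 (κ x) (κ' x) + 5 * ε := by
      filter_upwards [hκ, hκ'] with x hx hx'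
      have hupper : ∫⁻ y, ∫⁻ y', H (x, y, y') * edist y y' ∂κ' x ∂κ x ≤
          ∑ i, ∑ j, M x i j * c i j + 2 * ε := by
        have h := lintegral_lintegral_liftDensity_mul hT (hrow x) (hcol x)
          fun i j => c i j + 2 * ε
        simp only [mul_add, Finset.sum_add_distrib, ← Finset.sum_mul] at h
        simp only [hrow x, sum_measure_fiber hT, measure_univ, one_mul] at h
        rw [← h]
        refine lintegral_mono_ae ?_
        filter_upwards [hx] with y hy
        refine lintegral_mono_ae ?_
        filter_upwards [hx'] with y' hy'
        rw [← mul_add]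
        refine mul_le_mul_right ?_ _
        calc edist y y' ≤ edist y (t (T y)) + edist (t (T y)) (t (T y')) + edist (t (T y')) y' :=
              edist_triangle4 _ _ _ _
          _ ≤ ε + c (T y) (T y') + ε := by
              gcongr
              · rw [edist_comm]; exact htT y hy
              · exact htT y' hy'
          _ = c (T y) (T y') + 2 * ε := by ring
      have hlower : ∑ i, ∑ j, M x i j * c i j ≤ W1 (κ x) (κ' x) + 3 * ε := by
        rw [← tsub_le_iff_right]
        refine le_iInf fun γ => le_iInf fun h1 => le_iInf fun h2 => ?_
        rw [tsub_le_iff_right]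
        obtain ⟨hr, hc⟩ := sum_coupling_fiber hT h1 h2
        refine (hcost x _ hr hc).trans ?_
        have h := lintegral_comp_fintype (hT.prodMap hT) γ fun p : Fin n × Fin n => c p.1 p.2
        rw [Fintype.sum_prod_type] at h
        simp only [mul_comm (c _ _)] at h
        rw [← h]
        have hγ : γ univ = 1 := by
          rw [← preimage_univ (f := Prod.fst), ← Measure.map_apply measurable_fst .univ, h1,
            measure_univ]
        rw [← h1] at hx
        rw [← h2] at hx'
        calc _ ≤ ∫⁻ p, edist p.1 p.2 + 2 * ε ∂γ + ε := by
              gcongr ?_ + ε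
              refine lintegral_mono_ae ?_
              filter_upwards [ae_of_ae_map measurable_fst.aemeasurable hx,
                ae_of_ae_map measurable_snd.aemeasurable hx'] with p hp hp'
              calc c (T p.1) (T p.2) ≤ edist (t (T p.1)) p.1 + edist p.1 p.2 +
                    edist p.2 (t (T p.2)) := edist_triangle4 _ _ _ _
                _ ≤ ε + edist p.1 p.2 + ε := by
                    gcongr
                    · exact htT _ hp
                    · rw [edist_comm]; exact htT _ hp'
                _ = edist p.1 p.2 + 2 * ε := by ring
          _ = ∫⁻ p, edist p.1 p.2 ∂γ + 3 * ε := by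
              rw [lintegral_add_right _ measurable_const, lintegral_const, hγ]
              ring
      calc _ ≤ ∑ i, ∑ j, M x i j * c i j + 2 * ε := hupper
        _ ≤ W1 (κ x) (κ' x) + 3 * ε + 2 * ε := by gcongr
        _ = W1 (κ x) (κ' x) + 5 * ε := by ring
    refine (lintegral_mono_ae hbound).trans_eq ?_
    rw [lintegral_add_right _ measurable_const, lintegral_const, hμ, mul_one]

open ProbabilityTheory in
/-- The fiberwise Wasserstein distances integrate to at most the cost of any vertical coupling. -/
theorem lintegral_W1_condKernel_le {X Ω : Type*} [MeasurableSpace X] [PseudoEMetricSpace Ω]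
    [SecondCountableTopology Ω] [MeasurableSpace Ω] [OpensMeasurableSpace Ω]
    [StandardBorelSpace Ω] [Nonempty Ω]
    (P : Measure (X × Ω × Ω)) [IsFiniteMeasure P] {μ : Measure X} {π π' : Measure (X × Ω)}
    [IsFiniteMeasure π] [IsFiniteMeasure π'] (hπ : π.fst = μ) (hπ' : π'.fst = μ)
    (h1 : P.map (fun p => (p.1, p.2.1)) = π) (h2 : P.map (fun p => (p.1, p.2.2)) = π') :
    ∫⁻ x, W1 (π.condKernel x) (π'.condKernel x) ∂μ ≤ ∫⁻ p, edist p.2.1 p.2.2 ∂P := by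
  have hP : P.fst = μ := by
    rw [← hπ, ← h1, Measure.fst, Measure.fst, Measure.map_map measurable_fst (by fun_prop)]
    rfl
  have hdis : P = μ ⊗ₘ P.condKernel := by rw [← hP, P.disintegrate]
  have key : ∀ {ρ : Measure (X × Ω)} [IsFiniteMeasure ρ] {f : Ω × Ω → Ω}, Measurable f →
      ρ.fst = μ → P.map (Prod.map id f) = ρ →
      ∀ᵐ x ∂μ, (P.condKernel x).map f = ρ.condKernel x := by
    intro ρ _ f hf hρ hPρ
    rw [← hρ]
    filter_upwards [eq_condKernel_of_measure_eq_compProd (ρ := ρ) (P.condKernel.map f)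
      (by rw [hρ, ← hP, Measure.compProd_map hf, P.disintegrate, hPρ])] with x hx
    rw [← hx, Kernel.map_apply _ hf]
  conv_rhs => rw [hdis]
  have : IsFiniteMeasure μ := hP ▸ inferInstance
  rw [Measure.lintegral_compProd (by fun_prop)]
  refine lintegral_mono_ae ?_
  filter_upwards [key measurable_fst hπ h1, key measurable_snd hπ' h2] with x hx hx'
  exact iInf_le_of_le _ (iInf_le_of_le hx (iInf_le _ hx'))

theorem disint_eq_condKernel {α Ω : Type*} [MeasurableSpace α] [MeasurableSpace Ω]
    [StandardBorelSpace Ω] [Nonempty Ω] (π : Measure (α × Ω)) [IsFiniteMeasure π] (x : α) :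
    disint π x = π.condKernel x := by
  rw [disint, dif_pos]

theorem edistE2_of_fst_eq {d₁ d₂ : ℕ} {p q : E d₁ × E d₂} (h : p.1 = q.1) :
    edistE2 p q = edist p.2 q.2 := by
  rw [edistE2, h, dist_self, zero_pow two_ne_zero, zero_add, Real.sqrt_sq dist_nonneg,
    edist_dist]

/-- the vertical transport metric `𝒲` equals the optimal transport cost on
`X × Y` (Euclidean distance on `ℝ^{2d}`) restricted to couplings that only move mass
vertically, i.e. with `x = x'` almost everywhere. -/
theorem stmt14 (d : ℕ) (Y : Set (E d)) (hY : IsCompact Y)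
    (μ : Measure (E d)) [IsProbabilityMeasure μ]
    (π π' : Measure (E d × E d)) [IsProbabilityMeasure π] [IsProbabilityMeasure π']
    (hπ : π.map Prod.fst = μ) (hπ' : π'.map Prod.fst = μ)
    (hπs : π (Xcube d ×ˢ Y)ᶜ = 0) (hπ's : π' (Xcube d ×ˢ Y)ᶜ = 0) :
    VW μ π π' =
      ⨅ (γ : Measure ((E d × E d) × (E d × E d))) (_ : IsProbabilityMeasure γ)
        (_ : γ.map Prod.fst = π) (_ : γ.map Prod.snd = π')
        (_ : ∀ᵐ q ∂γ, q.1.1 = q.2.1),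
        ∫⁻ q, edistE2 q.1 q.2 ∂γ := by
  simp only [VW, disint_eq_condKernel]
  have hYs : ∀ {ρ : Measure (E d × E d)} [IsProbabilityMeasure ρ], ρ.map Prod.fst = μ →
      ρ (Xcube d ×ˢ Y)ᶜ = 0 → ∀ᵐ x ∂μ, ∀ᵐ y ∂ρ.condKernel x, y ∈ Y := by
    intro ρ _ hρ hs
    refine Measure.ae_ae_of_ae_compProd (p := fun p : E d × E d => p.2 ∈ Y) ?_
    rw [← hρ, ← Measure.fst, ρ.disintegrate]
    exact (measure_eq_zero_iff_ae_notMem.1 hs).mono fun p hp => (not_not.1 hp).2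
  refine le_antisymm ?_ ?_
  · refine le_iInf fun γ => le_iInf fun _ => le_iInf fun h1 => le_iInf fun h2 => le_iInf fun h => ?_
    have hg : Measurable fun q : (E d × E d) × (E d × E d) => (q.1.1, q.1.2, q.2.2) := by fun_prop
    have := Measure.isProbabilityMeasure_map (μ := γ) hg.aemeasurable
    refine (lintegral_W1_condKernel_le (γ.map fun q => (q.1.1, q.1.2, q.2.2)) hπ hπ' ?_ ?_).trans ?_
    · rw [Measure.map_map (by fun_prop) hg, ← h1]
      rfl
    · rw [Measure.map_map (by fun_prop) hg, ← h2]
      refine Measure.map_congr ?_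
      filter_upwards [h] with q hq
      exact Prod.ext hq rfl
    · rw [lintegral_map (by fun_prop) hg]
      refine (lintegral_congr_ae ?_).le
      filter_upwards [h] with q hq
      exact (edistE2_of_fst_eq hq).symm
  · refine ENNReal.le_of_forall_pos_le_add fun δ hδ _ => ?_
    have hδ0 : (δ : ℝ≥0∞) ≠ 0 := by exact_mod_cast hδ.ne'
    obtain ⟨P, h1, h2, hP⟩ := exists_vertical_coupling (μ := μ) (κ := π.condKernel)
      (κ' := π'.condKernel) measure_univ hY (hYs hπ hπs) (hYs hπ' hπ's) (ε := δ / 5)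
      (ENNReal.div_ne_zero.2 ⟨hδ0, by norm_num⟩) (ENNReal.div_ne_top (by simp) (by norm_num))
    rw [ENNReal.mul_div_cancel (by norm_num) (by norm_num)] at hP
    refine le_trans ?_ hP
    have hg : Measurable fun p : E d × E d × E d => ((p.1, p.2.1), (p.1, p.2.2)) := by fun_prop
    have hfst : (P.map fun p => ((p.1, p.2.1), (p.1, p.2.2))).map Prod.fst = π := by
      rw [Measure.map_map measurable_fst hg, ← π.disintegrate π.condKernel, Measure.fst, hπ, ← h1]
      rfl
    have hsnd : (P.map fun p => ((p.1, p.2.1), (p.1, p.2.2))).map Prod.snd = π' := by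
      rw [Measure.map_map measurable_snd hg, ← π'.disintegrate π'.condKernel, Measure.fst, hπ',
        ← h2]
      rfl
    have hprob : IsProbabilityMeasure (P.map fun p => ((p.1, p.2.1), (p.1, p.2.2))) :=
      @Measure.isProbabilityMeasure_of_map _ _ _ _ _ Prod.fst (by rw [hfst]; infer_instance)
    have hvert : ∀ᵐ q ∂(P.map fun p => ((p.1, p.2.1), (p.1, p.2.2))), q.1.1 = q.2.1 :=
      (ae_map_iff hg.aemeasurable (measurableSet_eq_fun (by fun_prop) (by fun_prop))).2
        (ae_of_all _ fun _ => rfl)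
    refine iInf_le_of_le _ (iInf_le_of_le hprob (iInf_le_of_le hfst (iInf_le_of_le hsnd
      (iInf_le_of_le hvert ?_))))
    refine (lintegral_map_le _ _).trans_eq (lintegral_congr fun p => edistE2_of_fst_eq rfl)
end
end
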